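/- For every n ≥ 3, a closed ball in ℝⁿ and a cube in ℝⁿ of the same Lebesgue measure are equidecomposable using pieces that are Lebesgue measurable (the higher-dimensional measurable version of Tarski's circle squaring). -/

import Mathlib

open MeasureTheory Set

noncomputable section

/-- `n`-dimensional Euclidean space `ℝⁿ`. -/
abbrev EucSp (n : ℕ) : Type := EuclideanSpace ℝ (Fin n)

/-- `A` and `B` are equidecomposable with Lebesgue measurable pieces. -/
def MeasurablyEquidecomposable (n : ℕ) (A B : Set (EucSp n)) : Prop :=
  ∃ (m : ℕ) (γ : Fin m → (EucSp n ≃ᵢ EucSp n)) (P : Fin m → Set (EucSp n)),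
    (∀ i, NullMeasurableSet (P i) volume) ∧
    (∀ i j, i ≠ j → Disjoint (P i) (P j)) ∧
    (⋃ i, P i) = A ∧
    (∀ i j, i ≠ j → Disjoint ((γ i) '' P i) ((γ j) '' P j)) ∧
    (⋃ i, (γ i) '' P i) = B

/-- `C ⊆ ℝⁿ` is a cube: an isometric copy of `[0, a]ⁿ` for some side length `a > 0`. -/
def IsCube (n : ℕ) (C : Set (EucSp n)) : Prop :=
  ∃ (a : ℝ) (γ : EucSp n ≃ᵢ EucSp n), 0 < a ∧
    γ '' {x : EucSp n | ∀ i, x i ∈ Set.Icc (0 : ℝ) a} = C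

/-! ### Five-adic ping-pong for coordinate-plane rotations -/

/-- Ordered pairs of distinct coordinates. -/
abbrev CoordPair (n : ℕ) : Type := {p : Fin n × Fin n // p.1 ≠ p.2}

/-- The `(i, j)`-th rotation, with cosine `3/5` and sine `4/5`, acting on coordinate vectors. -/
def pairRot {n : ℕ} {K : Type*} [Field K] (p : CoordPair n) (x : Fin n → K) (k : Fin n) : K :=
  if k = p.1.1 then (3 * x p.1.1 - 4 * x p.1.2) / 5
  else if k = p.1.2 then (4 * x p.1.1 + 3 * x p.1.2) / 5 else x k

lemma pairRot_fst {n : ℕ} {K : Type*} [Field K] (p : CoordPair n) (x : Fin n → K) :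
    pairRot p x p.1.1 = (3 * x p.1.1 - 4 * x p.1.2) / 5 := by simp [pairRot]

lemma pairRot_snd {n : ℕ} {K : Type*} [Field K] (p : CoordPair n) (x : Fin n → K) :
    pairRot p x p.1.2 = (4 * x p.1.1 + 3 * x p.1.2) / 5 := by
  simp [pairRot, p.2.symm]

lemma pairRot_of_ne {n : ℕ} {K : Type*} [Field K] (p : CoordPair n) (x : Fin n → K) {k : Fin n}
    (h₁ : k ≠ p.1.1) (h₂ : k ≠ p.1.2) : pairRot p x k = x k := by simp [pairRot, h₁, h₂]

/-- Vectors whose component along the expanding direction of the rotation has maximal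
five-adic norm. -/
def Expanded {n : ℕ} (p : CoordPair n) (z : Fin n → ℚ) : Prop :=
  z p.1.2 - 2 * z p.1.1 ≠ 0 ∧
    ∀ k, padicNorm 5 (z k) ≤ padicNorm 5 (z p.1.2 - 2 * z p.1.1)

/-- Vectors five-adically close to the expanding direction of the rotation. -/
def Attracted {n : ℕ} (p : CoordPair n) (z : Fin n → ℚ) : Prop :=
  padicNorm 5 (z p.1.2 + 2 * z p.1.1) < padicNorm 5 (z p.1.1) ∧
    ∀ k, k ≠ p.1.1 → k ≠ p.1.2 → padicNorm 5 (z k) < padicNorm 5 (z p.1.1)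

instance fact_prime_five : Fact (Nat.Prime 5) := ⟨by norm_num⟩

lemma padicNorm_five_natCast_mul {m : ℕ} (hm : ¬ 5 ∣ m) (x : ℚ) :
    padicNorm 5 (m * x) = padicNorm 5 x := by
  rw [padicNorm.mul, (padicNorm.nat_eq_one_iff (p := 5) m).2 hm, one_mul]

lemma padicNorm_five_two_mul (x : ℚ) : padicNorm 5 (2 * x) = padicNorm 5 x := by
  exact_mod_cast padicNorm_five_natCast_mul (m := 2) (by norm_num) x

lemma padicNorm_five_three_mul (x : ℚ) : padicNorm 5 (3 * x) = padicNorm 5 x := by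
  exact_mod_cast padicNorm_five_natCast_mul (m := 3) (by norm_num) x

lemma padicNorm_five_four_mul (x : ℚ) : padicNorm 5 (4 * x) = padicNorm 5 x := by
  exact_mod_cast padicNorm_five_natCast_mul (m := 4) (by norm_num) x

lemma padicNorm_five_five_mul (x : ℚ) : padicNorm 5 (5 * x) = padicNorm 5 x / 5 := by
  have h := padicNorm.padicNorm_p_of_prime (p := 5)
  rw [padicNorm.mul]
  push_cast at h
  rw [h]; ring

lemma padicNorm_five_div_five (x : ℚ) : padicNorm 5 (x / 5) = 5 * padicNorm 5 x := by
  have h := padicNorm_five_five_mul (x / 5)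
  rw [mul_div_cancel₀ x (by norm_num : (5 : ℚ) ≠ 0)] at h
  rw [h]; ring

lemma padicNorm_add_eq_right_of_lt {x y : ℚ} (h : padicNorm 5 x < padicNorm 5 y) :
    padicNorm 5 (x + y) = padicNorm 5 y := by
  rw [padicNorm.add_eq_max_of_ne h.ne, max_eq_right h.le]

lemma Attracted.expanded {n : ℕ} {p : CoordPair n} {z : Fin n → ℚ} (h : Attracted p z) :
    Expanded p z := by
  obtain ⟨h₁, h₂⟩ := h
  have e₁ : padicNorm 5 (z p.1.2 - 2 * z p.1.1) = padicNorm 5 (z p.1.1) := by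
    have := padicNorm_add_eq_right_of_lt (x := z p.1.2 + 2 * z p.1.1) (y := -(4 * z p.1.1))
      (by rwa [padicNorm.neg, padicNorm_five_four_mul])
    rw [padicNorm.neg, padicNorm_five_four_mul] at this
    rw [← this]; congr 1; ring
  have e₂ : padicNorm 5 (z p.1.2) = padicNorm 5 (z p.1.1) := by
    have := padicNorm_add_eq_right_of_lt (x := z p.1.2 + 2 * z p.1.1) (y := -(2 * z p.1.1))
      (by rwa [padicNorm.neg, padicNorm_five_two_mul])
    rw [padicNorm.neg, padicNorm_five_two_mul] at this
    rw [← this]; congr 1; ring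
  refine ⟨fun h0 => ?_, fun k => ?_⟩
  · rw [h0, padicNorm.zero] at e₁
    rw [← e₁] at h₁
    exact absurd h₁ (not_lt.2 (padicNorm.nonneg _))
  · rw [e₁]
    by_cases hk₁ : k = p.1.1
    · rw [hk₁]
    by_cases hk₂ : k = p.1.2
    · rw [hk₂, e₂]
    exact (h₂ k hk₁ hk₂).le

lemma Expanded.attracted_pairRot {n : ℕ} {p : CoordPair n} {z : Fin n → ℚ} (h : Expanded p z) :
    Attracted p (pairRot p z) := by
  obtain ⟨h₀, h⟩ := h
  have hpos : 0 < padicNorm 5 (z p.1.2 - 2 * z p.1.1) :=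
    lt_of_le_of_ne (padicNorm.nonneg _) (padicNorm.nonzero h₀).symm
  have e : padicNorm 5 (pairRot p z p.1.1) = 5 * padicNorm 5 (z p.1.2 - 2 * z p.1.1) := by
    rw [pairRot_fst, padicNorm_five_div_five]
    congr 1
    have := padicNorm_add_eq_right_of_lt (x := -(5 * z p.1.1))
      (y := -(4 * (z p.1.2 - 2 * z p.1.1))) (by
        rw [padicNorm.neg, padicNorm.neg, padicNorm_five_four_mul, padicNorm_five_five_mul]
        have := h p.1.1
        linarith)
    rw [padicNorm.neg, padicNorm_five_four_mul] at this
    rw [← this]; congr 1; ring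
  refine ⟨?_, fun k hk₁ hk₂ => ?_⟩
  · rw [e, pairRot_fst, pairRot_snd]
    have : (4 * z p.1.1 + 3 * z p.1.2) / 5 + 2 * ((3 * z p.1.1 - 4 * z p.1.2) / 5)
        = -(z p.1.2 - 2 * z p.1.1) := by ring
    rw [this, padicNorm.neg]
    linarith
  · rw [e, pairRot_of_ne p z hk₁ hk₂]
    have := h k
    linarith

lemma exists_expanded_not_attracted {n : ℕ} (hn : 3 ≤ n) {z : Fin n → ℚ} (hz : z ≠ 0) :
    ∃ p : CoordPair n, Expanded p z ∧ ¬ Attracted p z := by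
  have : Nonempty (Fin n) := ⟨⟨0, by omega⟩⟩
  obtain ⟨a, ha⟩ := Finite.exists_max fun k => padicNorm 5 (z k)
  have hza : 0 < padicNorm 5 (z a) := by
    refine lt_of_le_of_ne (padicNorm.nonneg _) fun h0 => hz ?_
    funext k
    refine padicNorm.zero_of_padicNorm_eq_zero (p := 5) (le_antisymm ?_ (padicNorm.nonneg _))
    rw [h0]; exact ha k
  by_contra! H
  have key : ∀ p : CoordPair n, padicNorm 5 (z a) ≤ padicNorm 5 (z p.1.2 - 2 * z p.1.1) →
      Attracted p z := fun p hp => H p ⟨fun h0 => by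
        rw [h0, padicNorm.zero] at hp; exact absurd hza (not_lt.2 hp), fun k => (ha k).trans hp⟩
  have claim : ∀ b, (hb : b ≠ a) → Attracted ⟨(a, b), hb.symm⟩ z ∨ Attracted ⟨(b, a), hb⟩ z := by
    intro b hb
    by_contra! hcon
    have h₁ := lt_of_not_ge (mt (key _) hcon.1)
    have h₂ := lt_of_not_ge (mt (key _) hcon.2)
    simp only at h₁ h₂
    have h₃ : padicNorm 5 (3 * z a)
        ≤ max (padicNorm 5 (2 * (z b - 2 * z a))) (padicNorm 5 (z a - 2 * z b)) := by
      rw [← padicNorm.neg]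
      convert padicNorm.nonarchimedean (p := 5) using 2
      ring
    rw [padicNorm_five_three_mul, padicNorm_five_two_mul] at h₃
    exact absurd (max_lt h₁ h₂) (not_lt.2 h₃)
  obtain ⟨b, hb⟩ : ∃ b, b ≠ a := by
    have : Nontrivial (Fin n) := Fin.nontrivial_iff_two_le.2 (by omega)
    exact exists_ne a
  obtain ⟨c, hc⟩ : ∃ c, c ∉ ({a, b} : Finset (Fin n)) := by
    by_contra! hall
    have h := Finset.card_le_card (fun x _ => hall x : (Finset.univ : Finset (Fin n)) ⊆ {a, b})
    have h' := Finset.card_le_two (a := a) (b := b)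
    rw [Finset.card_univ, Fintype.card_fin] at h
    omega
  simp only [Finset.mem_insert, Finset.mem_singleton, not_or] at hc
  have hlt : padicNorm 5 (z b) < padicNorm 5 (z a) := by
    rcases claim c hc.1 with h | h
    · exact h.2 b hb (Ne.symm hc.2)
    · exact (h.2 b (Ne.symm hc.2) hb).trans_le (ha c)
  rcases claim b hb with h | h
  · have h₁ := h.1
    have h₂ := padicNorm_add_eq_right_of_lt (x := z b) (y := 2 * z a)
      (by rwa [padicNorm_five_two_mul])
    rw [padicNorm_five_two_mul] at h₂
    simp only at h₁
    exact absurd h₁ (by rw [h₂]; exact lt_irrefl _)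
  · have h₁ := h.1
    have h₂ := padicNorm_add_eq_right_of_lt (x := 2 * z b) (y := z a)
      (by rwa [padicNorm_five_two_mul])
    simp only at h₁
    rw [add_comm, h₂] at h₁
    exact absurd (h₁.trans hlt) (lt_irrefl _)

lemma sum_pairRot_sq {n : ℕ} (p : CoordPair n) (x : Fin n → ℝ) :
    ∑ k, pairRot p x k ^ 2 = ∑ k, x k ^ 2 := by
  have hmem : p.1.2 ∈ Finset.univ.erase p.1.1 :=
    Finset.mem_erase.2 ⟨p.2.symm, Finset.mem_univ _⟩
  rw [← Finset.add_sum_erase _ _ (Finset.mem_univ p.1.1), ← Finset.add_sum_erase _ _ hmem,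
    ← Finset.add_sum_erase _ (fun k => x k ^ 2) (Finset.mem_univ p.1.1),
    ← Finset.add_sum_erase _ (fun k => x k ^ 2) hmem, pairRot_fst, pairRot_snd,
    Finset.sum_congr rfl fun k hk => ?_]
  · ring
  · rw [Finset.mem_erase, Finset.mem_erase] at hk
    rw [pairRot_of_ne p x hk.2.1 hk.1]

/-- The rotation `pairRot` as a linear isometry of Euclidean space. -/
def planeRot {n : ℕ} (p : CoordPair n) : EucSp n ≃ₗᵢ[ℝ] EucSp n :=
  LinearIsometry.toLinearIsometryEquiv
    { toFun := fun x => WithLp.toLp 2 (pairRot p x)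
      map_add' := fun x y => by
        ext k
        simp only [pairRot, PiLp.add_apply]
        split_ifs <;> ring
      map_smul' := fun c x => by
        ext k
        simp only [pairRot, PiLp.smul_apply, smul_eq_mul, RingHom.id_apply]
        split_ifs <;> ring
      norm_map' := fun x => by
        simp only [LinearMap.coe_mk, AddHom.coe_mk, EuclideanSpace.norm_eq, Real.norm_eq_abs,
          sq_abs]
        rw [sum_pairRot_sq] } rfl

lemma map_pairRot {n : ℕ} (φ : ℝ →ₗ[ℚ] ℚ) (p : CoordPair n) (x : Fin n → ℝ) (k : Fin n) :
    φ (pairRot p x k) = pairRot p (fun k => φ (x k)) k := by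
  have h₃ : ∀ y : ℝ, φ (3 * y) = 3 * φ y := fun y => by
    have := φ.map_smul (3 : ℚ) y
    rw [smul_eq_mul] at this
    rw [← this]
    congr 1
  have h₄ : ∀ y : ℝ, φ (4 * y) = 4 * φ y := fun y => by
    have := φ.map_smul (4 : ℚ) y
    rw [smul_eq_mul] at this
    rw [← this]
    congr 1
  have h₅ : ∀ y : ℝ, φ (y / 5) = φ y / 5 := fun y => by
    have := φ.map_smul (5⁻¹ : ℚ) y
    rw [div_eq_inv_mul, div_eq_inv_mul, ← smul_eq_mul (5⁻¹ : ℚ), ← this]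
    congr 1
    simp [Rat.smul_def]
  simp only [pairRot]
  split_ifs
  · rw [h₅, map_sub, h₃, h₄]
  · rw [h₅, map_add, h₃, h₄]
  · rfl

open Classical in
/-- A finite set of nonzero vectors is moved substantially by some coordinate rotation. -/
lemma card_le_sum_card_image_planeRot_sdiff {n : ℕ} (hn : 3 ≤ n) (U : Finset (EucSp n))
    (hU : 0 ∉ U) : U.card ≤ ∑ p : CoordPair n, (U.image (planeRot p) \ U).card := by
  have hc : ∀ x : U, ∃ k, (x : EucSp n) k ≠ 0 := fun x => by
    by_contra! h
    refine hU ?_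
    have : (x : EucSp n) = 0 := by ext k; exact h k
    rw [← this]; exact x.2
  choose c hc using hc
  obtain ⟨φ, hφ⟩ := Module.exists_dual_forall_apply_ne_zero (K := ℚ)
    (fun x : U => (x : EucSp n) (c x)) hc
  let z : EucSp n → Fin n → ℚ := fun x k => φ (x k)
  have hz : ∀ x ∈ U, z x ≠ 0 := fun x hx h => hφ ⟨x, hx⟩ (congrFun h _)
  have hrot : ∀ p x, z (planeRot p x) = pairRot p (z x) := fun p x => by
    funext k; exact map_pairRot φ p _ k
  have hcover : U ⊆ Finset.univ.biUnion fun p : CoordPair n =>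
      U.filter (fun x => Expanded p (z x)) \ U.filter (fun x => Attracted p (z x)) := by
    intro x hx
    obtain ⟨p, hp, hp'⟩ := exists_expanded_not_attracted hn (hz x hx)
    simp only [Finset.mem_biUnion, Finset.mem_univ, true_and, Finset.mem_sdiff, Finset.mem_filter]
    exact ⟨p, ⟨hx, hp⟩, fun h => hp' h.2⟩
  refine (Finset.card_le_card hcover).trans (Finset.card_biUnion_le.trans
    (Finset.sum_le_sum fun p _ => ?_))
  have hsub : U.filter (fun x => Attracted p (z x)) ⊆ U.filter (fun x => Expanded p (z x)) :=
    Finset.monotone_filter_right _ fun x _ hx => hx.expanded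
  rw [Finset.card_sdiff_of_subset hsub, Nat.sub_le_iff_le_add, add_comm,
    ← Finset.card_image_of_injective _ (planeRot p).injective]
  refine (Finset.card_le_card ?_).trans (Finset.card_union_le _ _)
  intro y hy
  obtain ⟨x, hx, rfl⟩ := Finset.mem_image.1 hy
  rw [Finset.mem_filter] at hx
  by_cases h : planeRot p x ∈ U
  · refine Finset.mem_union_left _ (Finset.mem_filter.2 ⟨h, ?_⟩)
    rw [hrot]; exact hx.2.attracted_pairRot
  · exact Finset.mem_union_right _ (Finset.mem_sdiff.2 ⟨Finset.mem_image_of_mem _ hx.1, h⟩)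

/-- The integer vector nearest to `τ • ξ`. -/
def nearestInt {n : ℕ} (τ : ℝ) (ξ : EucSp n) (k : Fin n) : ℤ := round (τ * ξ k)

/-- The frequencies whose rescaling by `τ` is not close to the integer lattice. -/
def farFromLattice (n : ℕ) (τ : ℝ) : Set (EucSp n) :=
  {ξ | ∃ k, 1 / (12 * n) < |τ * ξ k - round (τ * ξ k)|}

lemma measurable_nearestInt {n : ℕ} (τ : ℝ) : Measurable (nearestInt (n := n) τ) := by
  refine measurable_pi_lambda _ fun k => ?_
  have : Measurable fun x : ℝ => round x := by
    simp_rw [round_eq]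
    exact Int.measurable_floor.comp (measurable_id.add_const _)
  exact this.comp (by fun_prop)

lemma measurableSet_farFromLattice (n : ℕ) (τ : ℝ) : MeasurableSet (farFromLattice n τ) := by
  have : farFromLattice n τ = ⋃ k, {ξ | 1 / (12 * n) < |τ * ξ k - nearestInt τ ξ k|} := by
    ext ξ; simp [farFromLattice, nearestInt]
  rw [this]
  refine MeasurableSet.iUnion fun k => measurableSet_lt measurable_const ?_
  have h : Measurable fun ξ : EucSp n => ((nearestInt τ ξ k : ℤ) : ℝ) :=
    (measurable_from_top (f := fun z : ℤ => (z : ℝ))).comp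
      ((measurable_pi_apply k).comp (measurable_nearestInt τ))
  exact ((show Measurable fun ξ : EucSp n => τ * ξ k by fun_prop).sub h).abs

lemma nearestInt_planeRot {n : ℕ} (hn : 3 ≤ n) {τ : ℝ} (p : CoordPair n) {ξ : EucSp n}
    (h : ξ ∉ farFromLattice n τ) (h' : planeRot p ξ ∉ farFromLattice n τ) :
    (fun k => ((nearestInt τ (planeRot p ξ) k : ℤ) : ℚ))
      = pairRot p fun k => ((nearestInt τ ξ k : ℤ) : ℚ) := by
  have hδ : (1 : ℝ) / (12 * n) ≤ 1 / 36 := by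
    have : (3 : ℝ) ≤ n := by exact_mod_cast hn
    exact one_div_le_one_div_of_le (by norm_num) (by linarith)
  simp only [farFromLattice, mem_ofPred_eq, not_exists, not_lt] at h h'
  have e : ∀ k, |τ * ξ k - nearestInt τ ξ k| ≤ 1 / 36 := fun k => (h k).trans hδ
  have e' : ∀ k, |τ * pairRot p ξ k - nearestInt τ (planeRot p ξ) k| ≤ 1 / 36 :=
    fun k => (h' k).trans hδ
  have hi := abs_le.1 (e p.1.1)
  have hj := abs_le.1 (e p.1.2)
  funext k
  have hk := abs_le.1 (e k)
  have hk' := abs_le.1 (e' k)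
  set w := nearestInt τ (planeRot p ξ) k
  set a := nearestInt τ ξ p.1.1
  set b := nearestInt τ ξ p.1.2
  by_cases hk₁ : k = p.1.1
  · rw [hk₁, pairRot_fst] at hk' ⊢
    have hz : 5 * w - (3 * a - 4 * b) = 0 := by
      rw [← Int.abs_lt_one_iff, ← Int.cast_lt (R := ℝ)]
      push_cast
      rw [abs_lt]
      constructor <;> linarith [hk'.1, hk'.2, hi.1, hi.2, hj.1, hj.2]
    have hz' : (5 * w - (3 * a - 4 * b) : ℚ) = 0 := by exact_mod_cast hz
    linarith
  by_cases hk₂ : k = p.1.2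
  · rw [hk₂, pairRot_snd] at hk' ⊢
    have hz : 5 * w - (4 * a + 3 * b) = 0 := by
      rw [← Int.abs_lt_one_iff, ← Int.cast_lt (R := ℝ)]
      push_cast
      rw [abs_lt]
      constructor <;> linarith [hk'.1, hk'.2, hi.1, hi.2, hj.1, hj.2]
    have hz' : (5 * w - (4 * a + 3 * b) : ℚ) = 0 := by exact_mod_cast hz
    linarith
  · rw [pairRot_of_ne p _ hk₁ hk₂] at hk' ⊢
    have hz : w - nearestInt τ ξ k = 0 := by
      rw [← Int.abs_lt_one_iff, ← Int.cast_lt (R := ℝ)]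
      push_cast
      rw [abs_lt]
      constructor <;> linarith [hk'.1, hk'.2, hk.1, hk.2]
    have hz' : (w - nearestInt τ ξ k : ℚ) = 0 := by exact_mod_cast hz
    linarith

lemma nearestInt_ne_zero {n : ℕ} (hn : 3 ≤ n) {τ : ℝ} {ξ : EucSp n}
    (h : ξ ∉ farFromLattice n τ) (hξ : 1 ≤ ‖τ • ξ‖) :
    (fun k => ((nearestInt τ ξ k : ℤ) : ℚ)) ≠ 0 := by
  intro h0
  have hn' : (0 : ℝ) < n := by exact_mod_cast (by omega : 0 < n)
  simp only [farFromLattice, mem_ofPred_eq, not_exists, not_lt] at h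
  have hk : ∀ k, (τ • ξ) k ^ 2 ≤ (1 / (12 * n) : ℝ) ^ 2 := fun k => by
    have hz : round (τ * ξ k) = 0 := by
      have := congrFun h0 k
      simpa [nearestInt] using this
    have := h k
    rw [hz, Int.cast_zero, sub_zero] at this
    rw [PiLp.smul_apply, smul_eq_mul, ← sq_abs]
    gcongr
  have hs : ‖τ • ξ‖ ^ 2 ≤ n * (1 / (12 * n) : ℝ) ^ 2 := by
    rw [EuclideanSpace.real_norm_sq_eq]
    refine (Finset.sum_le_sum fun k _ => hk k).trans ?_
    simp
  have h1 : (1 : ℝ) ≤ ‖τ • ξ‖ ^ 2 := one_le_pow₀ hξ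
  have h2 : (n : ℝ) * (1 / (12 * n)) ^ 2 = 1 / (144 * n) := by field_simp; norm_num
  rw [h2] at hs
  have h3 : (1 : ℝ) / (144 * n) < 1 := by
    rw [div_lt_one (by positivity)]
    have : (3 : ℝ) ≤ n := by exact_mod_cast hn
    linarith
  linarith

/-- A measure on frequency space that is almost invariant under the coordinate rotations and
concentrated near a lattice has little mass away from the origin. -/
lemma measure_high_frequency_le {n : ℕ} (hn : 3 ≤ n) (τ : ℝ) (m : Measure (EucSp n))
    [IsFiniteMeasure m] (b : CoordPair n → ENNReal)
    (hb : ∀ p S, MeasurableSet S → m S ≤ m ((planeRot p).symm ⁻¹' S) + b p) :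
    m {ξ | 1 ≤ ‖τ • ξ‖} ≤ m (farFromLattice n τ)
      + ∑ p : CoordPair n, (m (farFromLattice n τ) + b p) := by
  set Bad := farFromLattice n τ
  have hBad : MeasurableSet Bad := measurableSet_farFromLattice n τ
  let z : EucSp n → Fin n → ℚ := fun ξ k => (nearestInt τ ξ k : ℤ)
  have hmeas : ∀ P : (Fin n → ℚ) → Prop, MeasurableSet {ξ | P (z ξ)} := fun P =>
    measurable_nearestInt τ (Set.to_countable {y : Fin n → ℤ | P fun k => y k}).measurableSet
  let H : Set (EucSp n) := {ξ | 1 ≤ ‖τ • ξ‖}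
  have hH : MeasurableSet H := measurableSet_le measurable_const (by fun_prop)
  let E : CoordPair n → Set (EucSp n) := fun p => (H \ Bad) ∩ {ξ | Expanded p (z ξ)}
  let F : CoordPair n → Set (EucSp n) := fun p => (H \ Bad) ∩ {ξ | Attracted p (z ξ)}
  have hE : ∀ p, MeasurableSet (E p) := fun p => (hH.diff hBad).inter (hmeas _)
  have hF : ∀ p, MeasurableSet (F p) := fun p => (hH.diff hBad).inter (hmeas _)
  have hcover : H ⊆ Bad ∪ ⋃ p, E p \ F p := by
    intro ξ hξ
    by_cases hB : ξ ∈ Bad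
    · exact Or.inl hB
    obtain ⟨p, hp, hp'⟩ := exists_expanded_not_attracted hn (nearestInt_ne_zero hn hB hξ)
    exact Or.inr (mem_iUnion.2 ⟨p, ⟨⟨hξ, hB⟩, hp⟩, fun h => hp' h.2⟩)
  refine (measure_mono hcover).trans ((measure_union_le _ _).trans ?_)
  gcongr
  refine (measure_iUnion_fintype_le m _).trans (Finset.sum_le_sum fun p _ => ?_)
  have hFE : F p ⊆ E p := fun ξ hξ => ⟨hξ.1, hξ.2.expanded⟩
  rw [measure_sdiff hFE (hF p).nullMeasurableSet (measure_ne_top _ _), tsub_le_iff_right]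
  refine (hb p _ (hE p)).trans ?_
  have hrot : (planeRot p).symm ⁻¹' E p ⊆ Bad ∪ F p := by
    intro η hη
    obtain ⟨ξ, rfl⟩ := (planeRot p).surjective η
    rw [mem_preimage, LinearIsometryEquiv.symm_apply_apply] at hη
    by_cases hB : planeRot p ξ ∈ Bad
    · exact Or.inl hB
    refine Or.inr ⟨⟨?_, hB⟩, ?_⟩
    · have : (1 : ℝ) ≤ ‖τ • ξ‖ := hη.1.1
      simpa [H, norm_smul] using this
    · have e : z (planeRot p ξ) = pairRot p (z ξ) := nearestInt_planeRot hn p hη.1.2 hB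
      change Attracted p (z (planeRot p ξ))
      rw [e]
      exact Expanded.attracted_pairRot hη.2
  calc m ((planeRot p).symm ⁻¹' E p) + b p ≤ m Bad + m (F p) + b p := by
        gcongr; exact (measure_mono hrot).trans (measure_union_le _ _)
    _ = m Bad + b p + m (F p) := by ring

lemma sq_eLpNorm_two {α : Type*} [MeasurableSpace α] (μ : Measure α) (f : α → ℂ) :
    eLpNorm f 2 μ ^ 2 = ∫⁻ x, ‖f x‖ₑ ^ 2 ∂μ := by
  have := eLpNorm_nnreal_pow_eq_lintegral (μ := μ) (f := f) (p := 2) two_ne_zero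
  simp only [ENNReal.coe_ofNat, NNReal.coe_ofNat, ENNReal.rpow_ofNat] at this
  exact this

lemma norm_fourierChar_sub_one (x : ℝ) :
    ‖(Real.fourierChar x : ℂ) - 1‖ = 2 * |Real.sin (Real.pi * x)| := by
  rw [Real.fourierChar_apply]
  have : ((2 * Real.pi * x : ℝ) : ℂ) * Complex.I = Complex.I * ((2 * Real.pi * x : ℝ) : ℂ) := by
    ring
  rw [this, Complex.norm_exp_I_mul_ofReal_sub_one, norm_mul, Real.norm_eq_abs, Real.norm_eq_abs,
    abs_two]
  congr 3
  ring

lemma norm_fourierChar_sub_one_le_two (x : ℝ) : ‖(Real.fourierChar x : ℂ) - 1‖ ≤ 2 := by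
  rw [norm_fourierChar_sub_one]
  have := Real.abs_sin_le_one (Real.pi * x)
  linarith

lemma norm_fourierChar_sub_one_le (x : ℝ) :
    ‖(Real.fourierChar x : ℂ) - 1‖ ≤ 2 * Real.pi * |x| := by
  rw [norm_fourierChar_sub_one]
  have := Real.abs_sin_le_abs (x := Real.pi * x)
  rw [abs_mul, abs_of_pos Real.pi_pos] at this
  linarith

lemma le_norm_fourierChar_sub_one (x : ℝ) :
    4 * |x - round x| ≤ ‖(Real.fourierChar x : ℂ) - 1‖ := by
  rw [norm_fourierChar_sub_one]
  have h1 : |Real.sin (Real.pi * x)| = Real.sin (Real.pi * |x - round x|) := by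
    have e : Real.pi * x = Real.pi * (x - round x) + round x * Real.pi := by ring
    have h0 : 0 ≤ Real.sin (Real.pi * |x - round x|) := by
      refine Real.sin_nonneg_of_nonneg_of_le_pi (by positivity) ?_
      nlinarith [abs_sub_round x, Real.pi_pos]
    rw [e, Real.sin_add_int_mul_pi, abs_mul, abs_zpow, abs_neg, abs_one, one_zpow, one_mul]
    rcases abs_cases (x - round x) with h | h
    · rw [h.1] at h0 ⊢
      exact abs_of_nonneg h0
    · rw [h.1] at h0 ⊢
      rw [mul_neg, Real.sin_neg] at h0 ⊢
      exact abs_of_nonpos (by linarith)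
  rw [h1]
  have h2 := Real.mul_le_sin (x := Real.pi * |x - round x|) (by positivity)
    (by nlinarith [abs_sub_round x, Real.pi_pos])
  have h3 : 2 / Real.pi * (Real.pi * |x - round x|) = 2 * |x - round x| := by
    field_simp
  linarith

open scoped SchwartzMap FourierTransform RealInnerProductSpace

lemma eLpNorm_fourier_schwartz {n : ℕ} (f : 𝓢(EucSp n, ℂ)) :
    eLpNorm (𝓕 f : 𝓢(EucSp n, ℂ)) 2 volume = eLpNorm f 2 volume := by
  have h := SchwartzMap.norm_fourier_toL2_eq f
  rw [SchwartzMap.norm_toLp, SchwartzMap.norm_toLp] at h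
  exact (ENNReal.toReal_eq_toReal_iff' ((𝓕 f).memLp 2 volume).2.ne (f.memLp 2 volume).2.ne).1 h

lemma fourier_translate_sub {n : ℕ} (f : 𝓢(EucSp n, ℂ)) (t ξ : EucSp n) :
    𝓕 (f.compSubConstCLM ℂ (-t) - f) ξ = ((Real.fourierChar ⟪t, ξ⟫ : ℂ) - 1) * 𝓕 f ξ := by
  have h : 𝓕 (f.compSubConstCLM ℂ (-t)) ξ = (Real.fourierChar ⟪t, ξ⟫ : ℂ) * 𝓕 f ξ := by
    have := congrFun (VectorFourier.fourierIntegral_comp_add_right Real.fourierChar volume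
      (innerₗ (EucSp n)) f t) ξ
    rw [SchwartzMap.fourier_coe, SchwartzMap.fourier_coe]
    have e : ((f.compSubConstCLM ℂ (-t) : 𝓢(EucSp n, ℂ)) : EucSp n → ℂ)
        = f ∘ fun v => v + t := by
      ext x; simp
    rw [e]
    exact this
  rw [sub_mul, one_mul, ← h, sub_eq_add_neg, FourierTransform.fourier_add, FourierTransform.fourier_neg]
  rfl

lemma lintegral_fourierChar_mul {n : ℕ} (f : 𝓢(EucSp n, ℂ)) (t : EucSp n) :
    ∫⁻ ξ, ‖(Real.fourierChar ⟪t, ξ⟫ : ℂ) - 1‖ₑ ^ 2 * ‖𝓕 f ξ‖ₑ ^ 2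
      = eLpNorm (fun x => f (x + t) - f x) 2 volume ^ 2 := by
  have h := eLpNorm_fourier_schwartz (f.compSubConstCLM ℂ (-t) - f)
  have e : ((f.compSubConstCLM ℂ (-t) - f : 𝓢(EucSp n, ℂ)) : EucSp n → ℂ)
      = fun x => f (x + t) - f x := by
    ext x; simp
  rw [e] at h
  rw [← h, sq_eLpNorm_two]
  refine lintegral_congr fun ξ => ?_
  rw [fourier_translate_sub, enorm_mul, mul_pow]

lemma isometryEquiv_measurePreserving {n : ℕ} (g : EucSp n ≃ᵢ EucSp n) :
    MeasurePreserving g (volume : Measure (EucSp n)) volume := by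
  have h := (measurePreserving_add_right (volume : Measure (EucSp n)) (g 0)).comp
    g.toRealLinearIsometryEquiv.measurePreserving
  have e : (fun x => x + g 0) ∘ g.toRealLinearIsometryEquiv = g := by
    ext x; simp
  rwa [e] at h

/-- The generating moves: translations by `τ` along coordinate axes and coordinate rotations. -/
def smallMove {n : ℕ} (τ : ℝ) : Fin n ⊕ CoordPair n → (EucSp n ≃ᵢ EucSp n)
  | .inl i => IsometryEquiv.addRight (τ • EuclideanSpace.single i 1)
  | .inr p => (planeRot p).toIsometryEquiv

/-- The energy distribution of a Schwartz function in frequency space. -/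
def spectralMeasure {n : ℕ} (f : 𝓢(EucSp n, ℂ)) : Measure (EucSp n) :=
  volume.withDensity fun ξ => ‖𝓕 f ξ‖ₑ ^ 2

lemma spectralMeasure_apply {n : ℕ} (f : 𝓢(EucSp n, ℂ)) {S : Set (EucSp n)}
    (hS : MeasurableSet S) :
    spectralMeasure f S = eLpNorm (𝓕 f : 𝓢(EucSp n, ℂ)) 2 (volume.restrict S) ^ 2 := by
  rw [spectralMeasure, withDensity_apply _ hS, sq_eLpNorm_two]

instance {n : ℕ} (f : 𝓢(EucSp n, ℂ)) : IsFiniteMeasure (spectralMeasure f) where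
  measure_univ_lt_top := by
    rw [spectralMeasure_apply f .univ, Measure.restrict_univ, eLpNorm_fourier_schwartz]
    exact ENNReal.pow_lt_top (f.memLp 2 volume).2

lemma eLpNorm_comp_sub_le {n : ℕ} (f : 𝓢(EucSp n, ℂ)) (g : EucSp n ≃ᵢ EucSp n) :
    eLpNorm (fun x => f (g x) - f x) 2 volume ≤ 2 * eLpNorm f 2 volume := by
  have hg := isometryEquiv_measurePreserving g
  have hf : AEStronglyMeasurable f (volume : Measure (EucSp n)) :=
    f.continuous.aestronglyMeasurable
  have := eLpNorm_sub_le (p := 2) (hf.comp_measurePreserving hg) hf (by norm_num)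
  rw [eLpNorm_comp_measurePreserving hf hg, ← two_mul] at this
  exact this

lemma spectralMeasure_le_planeRot {n : ℕ} (f : 𝓢(EucSp n, ℂ)) (p : CoordPair n)
    {S : Set (EucSp n)} (hS : MeasurableSet S) :
    spectralMeasure f S ≤ spectralMeasure f ((planeRot p).symm ⁻¹' S)
      + 4 * eLpNorm (fun x => f (planeRot p x) - f x) 2 volume * eLpNorm f 2 volume := by
  set d := eLpNorm (fun x => f (planeRot p x) - f x) 2 volume with hd
  set N := eLpNorm f 2 volume with hN
  have hdN : d ≤ 2 * N := eLpNorm_comp_sub_le f (planeRot p).toIsometryEquiv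
  let fρ : 𝓢(EucSp n, ℂ) :=
    SchwartzMap.compCLMOfContinuousLinearEquiv ℂ (planeRot p).toContinuousLinearEquiv f
  have hfρ : ∀ ξ, 𝓕 fρ ξ = 𝓕 f (planeRot p ξ) := fun ξ => by
    rw [SchwartzMap.fourier_coe, SchwartzMap.fourier_coe]
    exact Real.fourier_comp_linearIsometry (planeRot p) f ξ
  have hd' : eLpNorm ((𝓕 (fρ - f) : 𝓢(EucSp n, ℂ))) 2 volume = d := by
    rw [eLpNorm_fourier_schwartz]; rfl
  have hsub : ((𝓕 f : 𝓢(EucSp n, ℂ)) : EucSp n → ℂ)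
      = ((𝓕 fρ : 𝓢(EucSp n, ℂ)) : EucSp n → ℂ) - ((𝓕 (fρ - f) : 𝓢(EucSp n, ℂ)) : _ → ℂ) := by
    rw [sub_eq_add_neg fρ, FourierTransform.fourier_add, FourierTransform.fourier_neg]
    ext ξ; simp
  have hpre : spectralMeasure f ((planeRot p).symm ⁻¹' S)
      = eLpNorm (𝓕 fρ : 𝓢(EucSp n, ℂ)) 2 (volume.restrict S) ^ 2 := by
    rw [spectralMeasure, withDensity_apply _ ((planeRot p).symm.continuous.measurable hS),
      sq_eLpNorm_two]
    have hpp := (planeRot p).measurePreserving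
    rw [← hpp.setLIntegral_comp_preimage_emb
      (planeRot p).toHomeomorph.measurableEmbedding]
    rw [← preimage_comp]
    simp only [hfρ]
    congr 2
    ext x; simp
  set y := eLpNorm (𝓕 fρ : 𝓢(EucSp n, ℂ)) 2 (volume.restrict S) with hy
  have hyN : y ≤ N := by
    refine (eLpNorm_mono_measure _ Measure.restrict_le_self).trans ?_
    rw [eLpNorm_fourier_schwartz]
    exact (eLpNorm_comp_measurePreserving f.continuous.aestronglyMeasurable
      (planeRot p).measurePreserving).le
  have hx : eLpNorm (𝓕 f : 𝓢(EucSp n, ℂ)) 2 (volume.restrict S) ≤ y + d := by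
    rw [hsub]
    refine (eLpNorm_sub_le (SchwartzMap.continuous _).aestronglyMeasurable
      (SchwartzMap.continuous _).aestronglyMeasurable (by norm_num)).trans ?_
    gcongr
    rw [← hd']
    exact eLpNorm_mono_measure _ Measure.restrict_le_self
  rw [spectralMeasure_apply f hS, hpre]
  calc _ ≤ (y + d) ^ 2 := by gcongr
    _ = y ^ 2 + (2 * d * y + d * d) := by ring
    _ ≤ y ^ 2 + (2 * d * N + d * (2 * N)) := by gcongr
    _ = y ^ 2 + 4 * d * N := by ring

lemma spectralMeasure_farFromLattice_le {n : ℕ} (hn : 3 ≤ n) (τ : ℝ) (f : 𝓢(EucSp n, ℂ))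
    {σ : ENNReal} (hσ : ∀ s, eLpNorm (fun x => f (smallMove τ s x) - f x) 2 volume ≤ σ) :
    spectralMeasure f (farFromLattice n τ) ≤ 18 * n ^ 3 * (σ * eLpNorm f 2 volume) := by
  set N := eLpNorm f 2 volume with hN
  have hn' : (0 : ℝ) < n := by exact_mod_cast (by omega : 0 < n)
  have hi : ∀ i : Fin n, spectralMeasure f
      {ξ | 1 / (12 * n) < |τ * ξ i - round (τ * ξ i)|} ≤ 18 * n ^ 2 * (σ * N) := fun i => by
    set S := {ξ : EucSp n | 1 / (12 * n) < |τ * ξ i - round (τ * ξ i)|} with hS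
    have hmS : MeasurableSet S := by
      have h : Measurable fun ξ : EucSp n => ((nearestInt τ ξ i : ℤ) : ℝ) :=
        (measurable_from_top (f := fun z : ℤ => (z : ℝ))).comp
          ((measurable_pi_apply i).comp (measurable_nearestInt τ))
      exact measurableSet_lt measurable_const
        ((show Measurable fun ξ : EucSp n => τ * ξ i by fun_prop).sub h).abs
    have key := lintegral_fourierChar_mul f (τ • EuclideanSpace.single i 1)
    have hle : eLpNorm (fun x => f (x + τ • EuclideanSpace.single i 1) - f x) 2 volume ^ 2
        ≤ 2 * (σ * N) := by
      have h1 := hσ (.inl i)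
      have h2 := eLpNorm_comp_sub_le f (smallMove τ (.inl i))
      calc _ = _ * _ := sq _
        _ ≤ σ * (2 * N) := mul_le_mul' h1 h2
        _ = _ := by ring
    rw [← key] at hle
    have hlow : ∫⁻ ξ in S, ENNReal.ofReal (1 / (3 * n)) ^ 2 * ‖𝓕 f ξ‖ₑ ^ 2 ≤ 2 * (σ * N) := by
      refine le_trans (le_trans (setLIntegral_mono' hmS fun ξ hξ => ?_)
        (setLIntegral_le_lintegral S _)) hle
      gcongr
      rw [← ofReal_norm]
      refine ENNReal.ofReal_le_ofReal (le_trans ?_ (le_norm_fourierChar_sub_one _))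
      have e : ⟪τ • EuclideanSpace.single i (1 : ℝ), ξ⟫ = τ * ξ i := by
        rw [real_inner_smul_left, EuclideanSpace.inner_single_left]; simp
      rw [e]
      have : (1 : ℝ) / (3 * n) = 4 * (1 / (12 * n)) := by field_simp; norm_num
      rw [this]
      have := le_of_lt (show 1 / (12 * n) < |τ * ξ i - round (τ * ξ i)| from hξ)
      linarith
    rw [lintegral_const_mul' _ _ (by finiteness)] at hlow
    have hc : (ENNReal.ofReal (1 / (3 * n))) ^ 2 * (9 * n ^ 2) = 1 := by
      have : (9 * n ^ 2 : ENNReal) = ENNReal.ofReal (9 * n ^ 2) := by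
        rw [ENNReal.ofReal_mul (by norm_num), ENNReal.ofReal_pow hn'.le, ENNReal.ofReal_natCast]
        simp
      rw [this, ← ENNReal.ofReal_pow (by positivity), ← ENNReal.ofReal_mul (by positivity)]
      rw [show (1 / (3 * n) : ℝ) ^ 2 * (9 * n ^ 2) = 1 by field_simp; norm_num]
      simp
    calc spectralMeasure f S = ∫⁻ ξ in S, ‖𝓕 f ξ‖ₑ ^ 2 := withDensity_apply _ hmS
      _ = (9 * n ^ 2) * (ENNReal.ofReal (1 / (3 * n)) ^ 2 * ∫⁻ ξ in S, ‖𝓕 f ξ‖ₑ ^ 2) := by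
        rw [← mul_assoc, mul_comm (9 * _ : ENNReal), hc, one_mul]
      _ ≤ (9 * n ^ 2) * (2 * (σ * N)) := by gcongr
      _ = _ := by ring
  have hU : farFromLattice n τ
      = ⋃ i, {ξ : EucSp n | 1 / (12 * n) < |τ * ξ i - round (τ * ξ i)|} := by
    ext ξ; simp [farFromLattice]
  rw [hU]
  refine (measure_iUnion_fintype_le _ _).trans ((Finset.sum_le_sum fun i _ => hi i).trans ?_)
  rw [Finset.sum_const, Finset.card_univ, Fintype.card_fin, nsmul_eq_mul]
  exact le_of_eq (by ring)

/-- The constant in the translation estimate. -/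
def translationConst (n : ℕ) : ℕ :=
  4 * (18 * n ^ 3 + Fintype.card (CoordPair n) * (18 * n ^ 3 + 4))

lemma spectralMeasure_high_le {n : ℕ} (hn : 3 ≤ n) (τ : ℝ) (f : 𝓢(EucSp n, ℂ))
    {σ : ENNReal} (hσ : ∀ s, eLpNorm (fun x => f (smallMove τ s x) - f x) 2 volume ≤ σ) :
    4 * spectralMeasure f {ξ | 1 ≤ ‖τ • ξ‖}
      ≤ translationConst n * (σ * eLpNorm f 2 volume) := by
  set N := eLpNorm f 2 volume with hN
  have h := measure_high_frequency_le hn τ (spectralMeasure f) _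
    fun p S hS => spectralMeasure_le_planeRot f p hS
  have hb := spectralMeasure_farFromLattice_le hn τ f hσ
  have h' : spectralMeasure f {ξ | 1 ≤ ‖τ • ξ‖} ≤ 18 * n ^ 3 * (σ * N)
      + ∑ p : CoordPair n, (18 * n ^ 3 * (σ * N) + 4 * σ * N) := by
    refine h.trans ?_
    gcongr with p _
    exact hσ (.inr p)
  rw [Finset.sum_const, Finset.card_univ, nsmul_eq_mul] at h'
  calc _ ≤ _ := mul_le_mul_right h' 4
    _ = _ := by rw [translationConst]; push_cast; ring

/-- A Schwartz function almost invariant under the small moves is almost invariant under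
short translations. -/
lemma eLpNorm_translate_sub_sq_le {n : ℕ} (hn : 3 ≤ n) {τ : ℝ} (hτ : 0 < τ)
    (f : 𝓢(EucSp n, ℂ)) {σ : ENNReal}
    (hσ : ∀ s, eLpNorm (fun x => f (smallMove τ s x) - f x) 2 volume ≤ σ) (t : EucSp n) :
    eLpNorm (fun x => f (x + t) - f x) 2 volume ^ 2
      ≤ ENNReal.ofReal (2 * Real.pi * ‖t‖ / τ) ^ 2 * eLpNorm f 2 volume ^ 2
        + translationConst n * (σ * eLpNorm f 2 volume) := by
  rw [← lintegral_fourierChar_mul]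
  set H : Set (EucSp n) := {ξ | 1 ≤ ‖τ • ξ‖} with hH
  have hmH : MeasurableSet H := measurableSet_le measurable_const (by fun_prop)
  rw [← lintegral_add_compl _ hmH, add_comm]
  gcongr
  · calc ∫⁻ ξ in Hᶜ, ‖(Real.fourierChar ⟪t, ξ⟫ : ℂ) - 1‖ₑ ^ 2 * ‖𝓕 f ξ‖ₑ ^ 2
        ≤ ∫⁻ ξ in Hᶜ, ENNReal.ofReal (2 * Real.pi * ‖t‖ / τ) ^ 2 * ‖𝓕 f ξ‖ₑ ^ 2 := by
          refine setLIntegral_mono' hmH.compl fun ξ hξ => ?_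
          gcongr
          rw [← ofReal_norm]
          refine ENNReal.ofReal_le_ofReal ((norm_fourierChar_sub_one_le _).trans ?_)
          have h1 : ‖ξ‖ ≤ 1 / τ := by
            have : ¬ 1 ≤ ‖τ • ξ‖ := hξ
            rw [norm_smul, Real.norm_of_nonneg hτ.le, not_le] at this
            rw [le_div_iff₀ hτ]; linarith
          have h2 : |⟪t, ξ⟫| ≤ ‖t‖ * (1 / τ) :=
            (abs_real_inner_le_norm t ξ).trans (by gcongr)
          calc 2 * Real.pi * |⟪t, ξ⟫| ≤ 2 * Real.pi * (‖t‖ * (1 / τ)) := by gcongr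
            _ = _ := by ring
      _ ≤ ∫⁻ ξ, ENNReal.ofReal (2 * Real.pi * ‖t‖ / τ) ^ 2 * ‖𝓕 f ξ‖ₑ ^ 2 :=
          setLIntegral_le_lintegral _ _
      _ = _ := by
          rw [lintegral_const_mul' _ _ (by finiteness), ← sq_eLpNorm_two,
            eLpNorm_fourier_schwartz]
  · refine le_trans ?_ (spectralMeasure_high_le hn τ f hσ)
    rw [spectralMeasure, withDensity_apply _ hmH, ← lintegral_const_mul' _ _ (by norm_num)]
    refine lintegral_mono fun ξ => ?_
    have h4 : (4 : ENNReal) = 2 ^ 2 := by norm_num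
    rw [h4]
    gcongr
    rw [← ofReal_norm]
    refine (ENNReal.ofReal_le_ofReal (norm_fourierChar_sub_one_le_two _)).trans ?_
    simp

/-- The isometric action on `L²` of an isometry of the underlying space. -/
def isometryCompLp {n : ℕ} (g : EucSp n ≃ᵢ EucSp n) (f : Lp ℂ 2 (volume : Measure (EucSp n))) :
    Lp ℂ 2 (volume : Measure (EucSp n)) :=
  Lp.compMeasurePreserving g (isometryEquiv_measurePreserving g) f

lemma continuous_isometryCompLp {n : ℕ} (g : EucSp n ≃ᵢ EucSp n) :
    Continuous (isometryCompLp g) :=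
  (Lp.isometry_compMeasurePreserving (isometryEquiv_measurePreserving g)).continuous

lemma dist_isometryCompLp_toLp {n : ℕ} (g : EucSp n ≃ᵢ EucSp n) (f : 𝓢(EucSp n, ℂ)) :
    ENNReal.ofReal (dist (isometryCompLp g (f.toLp 2 volume)) (f.toLp 2 volume))
      = eLpNorm (fun x => f (g x) - f x) 2 volume := by
  have hm := isometryEquiv_measurePreserving g
  have hf := f.memLp 2 (volume : Measure (EucSp n))
  have e : isometryCompLp g (f.toLp 2 volume) - f.toLp 2 volume
      = ((hf.comp_measurePreserving hm).sub hf).toLp _ := rfl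
  rw [dist_eq_norm, e, Lp.norm_toLp, ENNReal.ofReal_toReal ((hf.comp_measurePreserving hm).sub hf).2.ne]
  rfl

/-- An `L²` function almost invariant under the small moves is almost invariant under
short translations. -/
lemma dist_isometryCompLp_sq_le {n : ℕ} (hn : 3 ≤ n) {τ : ℝ} (hτ : 0 < τ) (t : EucSp n)
    (f : Lp ℂ 2 (volume : Measure (EucSp n))) :
    dist (isometryCompLp (IsometryEquiv.addRight t) f) f ^ 2
      ≤ (2 * Real.pi * ‖t‖ / τ) ^ 2 * ‖f‖ ^ 2
        + translationConst n * ((∑ s, dist (isometryCompLp (smallMove τ s) f) f) * ‖f‖) := by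
  refine (SchwartzMap.denseRange_toLpCLM (F := ℂ) (p := 2) ENNReal.ofNat_ne_top).induction_on f
    (isClosed_le ?_ ?_) fun f => ?_
  · exact ((continuous_isometryCompLp _).dist continuous_id).pow 2
  · refine ((continuous_norm.pow 2).const_mul _).add (Continuous.const_mul ?_ _)
    exact (continuous_finsetSum _ fun s _ =>
      (continuous_isometryCompLp _).dist continuous_id).mul continuous_norm
  · simp only [SchwartzMap.toLpCLM_apply]
    have hσ : ∀ s, eLpNorm (fun x => f (smallMove τ s x) - f x) 2 volume
        ≤ ENNReal.ofReal (∑ s, dist (isometryCompLp (smallMove τ s) (f.toLp 2 volume)) (f.toLp 2 volume)) :=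
      fun s => by
        rw [← dist_isometryCompLp_toLp]
        exact ENNReal.ofReal_le_ofReal (Finset.single_le_sum
          (f := fun s => dist (isometryCompLp (smallMove τ s) (f.toLp 2 volume)) (f.toLp 2 volume))
          (fun _ _ => dist_nonneg) (Finset.mem_univ s))
    have h := eLpNorm_translate_sub_sq_le hn hτ f hσ t
    have hN : eLpNorm f 2 volume = ENNReal.ofReal ‖f.toLp 2 volume‖ := by
      rw [SchwartzMap.norm_toLp, ENNReal.ofReal_toReal (f.memLp 2 volume).2.ne]
    have ht := dist_isometryCompLp_toLp (IsometryEquiv.addRight t) f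
    simp only [IsometryEquiv.addRight_apply] at ht
    rw [← ht, hN, ← ENNReal.ofReal_natCast, ← ENNReal.ofReal_mul (by positivity),
      ← ENNReal.ofReal_mul (by positivity), ← ENNReal.ofReal_pow (by positivity),
      ← ENNReal.ofReal_pow (by positivity), ← ENNReal.ofReal_pow (by positivity),
      ← ENNReal.ofReal_mul (by positivity),
      ← ENNReal.ofReal_add (by positivity) (by positivity),
      ENNReal.ofReal_le_ofReal_iff (by positivity)] at h
    exact h

lemma dist_isometryCompLp_indicator {n : ℕ} (g : EucSp n ≃ᵢ EucSp n) {W : Set (EucSp n)}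
    (hW : MeasurableSet W) (hfin : volume W ≠ ⊤) :
    dist (isometryCompLp g (indicatorConstLp 2 hW hfin 1)) (indicatorConstLp 2 hW hfin 1)
      = √(volume.real (symmDiff (g ⁻¹' W) W)) := by
  rw [isometryCompLp, Lp.indicatorConstLp_compMeasurePreserving,
    dist_indicatorConstLp_eq_norm, norm_indicatorConstLp (by norm_num) (by norm_num),
    Real.sqrt_eq_rpow]
  simp

/-- A set almost invariant under the small moves is almost invariant under short
translations. -/
lemma volume_translate_symmDiff_le {n : ℕ} (hn : 3 ≤ n) {τ : ℝ} (hτ : 0 < τ)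
    {W : Set (EucSp n)} (hW : MeasurableSet W) (hfin : volume W ≠ ⊤) {ε : ℝ}
    (hε : ∀ s, volume.real (symmDiff (smallMove τ s ⁻¹' W) W) ≤ ε) (t : EucSp n) :
    volume.real (symmDiff ((fun x => x + t) ⁻¹' W) W)
      ≤ (2 * Real.pi * ‖t‖ / τ) ^ 2 * volume.real W
        + (translationConst n * Fintype.card (Fin n ⊕ CoordPair n) : ℕ)
          * (√ε * √(volume.real W)) := by
  have h := dist_isometryCompLp_sq_le hn hτ t (indicatorConstLp 2 hW hfin (1 : ℂ))
  simp only [dist_isometryCompLp_indicator] at h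
  rw [Real.sq_sqrt (by positivity), norm_indicatorConstLp (by norm_num) (by norm_num)] at h
  have e : ‖(1 : ℂ)‖ * volume.real W ^ (1 / (2 : ENNReal).toReal) = √(volume.real W) := by
    rw [Real.sqrt_eq_rpow]; simp
  rw [e, Real.sq_sqrt (by positivity)] at h
  refine h.trans ?_
  push_cast
  rw [add_le_add_iff_left, mul_assoc, ← mul_assoc (Fintype.card _ : ℝ)]
  gcongr
  refine (Finset.sum_le_sum (g := fun _ => √ε) fun s _ => Real.sqrt_le_sqrt (hε s)).trans ?_
  simp

open scoped Pointwise

/-- The union of the images of `U` under the isometries in `T`. -/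
def spread {n : ℕ} (T : Set (EucSp n ≃ᵢ EucSp n)) (U : Set (EucSp n)) : Set (EucSp n) :=
  ⋃ g ∈ T, g '' U

lemma mem_spread {n : ℕ} {T : Set (EucSp n ≃ᵢ EucSp n)} {U : Set (EucSp n)} {y : EucSp n} :
    y ∈ spread T U ↔ ∃ g ∈ T, ∃ x ∈ U, g x = y := by
  simp [spread]

lemma spread_mul {n : ℕ} (T T' : Set (EucSp n ≃ᵢ EucSp n)) (U : Set (EucSp n)) :
    spread (T * T') U = spread T (spread T' U) := by
  ext y
  simp only [mem_spread, Set.mem_mul]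
  constructor
  · rintro ⟨_, ⟨g, hg, h, hh, rfl⟩, x, hx, rfl⟩
    exact ⟨g, hg, h x, ⟨h, hh, x, hx, rfl⟩, rfl⟩
  · rintro ⟨g, hg, _, ⟨h, hh, x, hx, rfl⟩, rfl⟩
    exact ⟨g * h, ⟨g, hg, h, hh, rfl⟩, x, hx, rfl⟩

lemma spread_mono {n : ℕ} {T T' : Set (EucSp n ≃ᵢ EucSp n)} (h : T ⊆ T') {U U' : Set (EucSp n)}
    (hU : U ⊆ U') : spread T U ⊆ spread T' U' :=
  (biUnion_mono h fun _ _ => Set.image_mono hU)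

lemma subset_spread {n : ℕ} {T : Set (EucSp n ≃ᵢ EucSp n)} (h : 1 ∈ T) (U : Set (EucSp n)) :
    U ⊆ spread T U := fun x hx => mem_spread.2 ⟨1, h, x, hx, rfl⟩

lemma spread_one {n : ℕ} (U : Set (EucSp n)) : spread 1 U = U := by
  ext y; simp [mem_spread]

lemma measurableSet_image {n : ℕ} (g : EucSp n ≃ᵢ EucSp n) {U : Set (EucSp n)}
    (hU : MeasurableSet U) : MeasurableSet (g '' U) :=
  g.toHomeomorph.measurableEmbedding.measurableSet_image.2 hU

lemma volume_image {n : ℕ} (g : EucSp n ≃ᵢ EucSp n) (U : Set (EucSp n)) :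
    volume (g '' U) = volume U := by
  rw [← (isometryEquiv_measurePreserving g).measure_preimage_emb
    g.toHomeomorph.measurableEmbedding, g.injective.preimage_image]

lemma volume_preimage {n : ℕ} (g : EucSp n ≃ᵢ EucSp n) (U : Set (EucSp n)) :
    volume (g ⁻¹' U) = volume U :=
  (isometryEquiv_measurePreserving g).measure_preimage_emb g.toHomeomorph.measurableEmbedding U

lemma measurableSet_spread {n : ℕ} {T : Set (EucSp n ≃ᵢ EucSp n)} (hT : T.Finite)
    {U : Set (EucSp n)} (hU : MeasurableSet U) : MeasurableSet (spread T U) :=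
  hT.measurableSet_biUnion fun g _ => measurableSet_image g hU

lemma spread_pow_succ {n : ℕ} (T : Set (EucSp n ≃ᵢ EucSp n)) (k : ℕ) (U : Set (EucSp n)) :
    spread (T ^ (k + 1)) U = spread T (spread (T ^ k) U) := by
  rw [pow_succ', spread_mul]

lemma one_mem_pow {G : Type*} [Monoid G] {T : Set G} (h : 1 ∈ T) (k : ℕ) : 1 ∈ T ^ k := by
  simpa using Set.pow_mem_pow h (n := k)

lemma spread_pow_mono {n : ℕ} {T : Set (EucSp n ≃ᵢ EucSp n)} (h : 1 ∈ T) {j k : ℕ} (hjk : j ≤ k)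
    (U : Set (EucSp n)) : spread (T ^ j) U ⊆ spread (T ^ k) U :=
  spread_mono (Set.pow_subset_pow_right h hjk) subset_rfl

/-- The identity together with the small moves. -/
def smallMoves (n : ℕ) (τ : ℝ) : Set (EucSp n ≃ᵢ EucSp n) := insert 1 (range (smallMove τ))

lemma finite_smallMoves (n : ℕ) (τ : ℝ) : (smallMoves n τ).Finite := (finite_range _).insert _

lemma one_mem_smallMoves (n : ℕ) (τ : ℝ) : 1 ∈ smallMoves n τ := mem_insert _ _

lemma norm_smallMove_le {n : ℕ} {τ : ℝ} (hτ : 0 ≤ τ) {g : EucSp n ≃ᵢ EucSp n}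
    (hg : g ∈ smallMoves n τ) (x : EucSp n) : ‖g x‖ ≤ ‖x‖ + τ := by
  rcases hg with rfl | ⟨s | p, rfl⟩
  · simpa using hτ
  · refine (norm_add_le _ _).trans ?_
    simp [norm_smul, abs_of_nonneg hτ]
  · change ‖planeRot p x‖ ≤ _
    rw [LinearIsometryEquiv.norm_map]; linarith

lemma spread_smallMoves_pow_subset {n : ℕ} {τ : ℝ} (hτ : 0 ≤ τ) {U : Set (EucSp n)} {R : ℝ}
    (hU : U ⊆ Metric.closedBall 0 R) (k : ℕ) :
    spread (smallMoves n τ ^ k) U ⊆ Metric.closedBall 0 (R + k * τ) := by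
  induction k with
  | zero => simpa [spread_one] using hU
  | succ k ih =>
    rw [spread_pow_succ]
    intro y hy
    obtain ⟨g, hg, x, hx, rfl⟩ := mem_spread.1 hy
    have h1 := norm_smallMove_le hτ hg x
    have h2 := ih hx
    rw [mem_closedBall_zero_iff] at h2 ⊢
    push_cast
    linarith

lemma measureReal_symmDiff_preimage {n : ℕ} (g : EucSp n ≃ᵢ EucSp n) {W : Set (EucSp n)}
    (hW : MeasurableSet W) (hfin : volume W ≠ ⊤) :
    volume.real (symmDiff (g ⁻¹' W) W) = 2 * (volume.real W - volume.real (g ⁻¹' W ∩ W)) := by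
  have hp : volume.real (g ⁻¹' W) = volume.real W := by
    rw [measureReal_def, volume_preimage, measureReal_def]
  have hp' : volume (g ⁻¹' W) ≠ ⊤ := by rwa [volume_preimage]
  have hgW : MeasurableSet (g ⁻¹' W) := g.continuous.measurable hW
  have h0 := measureReal_symmDiff_eq (μ := volume) hgW hW hp' hfin
  have h1 := measureReal_sdiff_add_inter (μ := volume) (s := g ⁻¹' W) hW hp'
  have h2 := measureReal_sdiff_add_inter (μ := volume) (s := W) hgW hfin
  rw [inter_comm] at h2
  linarith

/-- The constant in the growth estimates. -/
def growthConst (n : ℕ) : ℕ := translationConst n * Fintype.card (Fin n ⊕ CoordPair n)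

/-- A set that grows little under the small moves is almost invariant under short
translations. -/
lemma volume_translate_symmDiff_le_of_growth {n : ℕ} (hn : 3 ≤ n) {τ : ℝ} (hτ : 0 < τ)
    {W : Set (EucSp n)} (hW : MeasurableSet W) (hfin : volume W ≠ ⊤) {η : ℝ}
    (hη : volume.real (spread (smallMoves n τ) W) ≤ volume.real W + η) (t : EucSp n) :
    volume.real (symmDiff ((fun x => x + t) ⁻¹' W) W)
      ≤ (2 * Real.pi * ‖t‖ / τ) ^ 2 * volume.real W
        + growthConst n * (√(2 * η) * √(volume.real W)) := by
  refine volume_translate_symmDiff_le hn hτ hW hfin (fun s => ?_) t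
  set g := smallMove τ s with hg
  have hfin' : volume (spread (smallMoves n τ) W) ≠ ⊤ :=
    ((measure_biUnion_lt_top (finite_smallMoves n τ) fun g _ => by
      rw [volume_image]; exact hfin.lt_top)).ne
  have hsub : W ∪ g '' W ⊆ spread (smallMoves n τ) W :=
    union_subset (subset_spread (one_mem_smallMoves n τ) W)
      (subset_biUnion_of_mem (u := fun g : EucSp n ≃ᵢ EucSp n => g '' W)
        (mem_insert_of_mem _ (mem_range_self s)))
  have h1 : volume.real (W ∪ g '' W) ≤ volume.real W + η :=
    (measureReal_mono hsub hfin').trans hη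
  have h2 := measureReal_union_add_inter (μ := volume) (s := W) (measurableSet_image g hW)
    hfin (by rwa [volume_image])
  have h3 : volume.real (g '' W) = volume.real W := by
    rw [measureReal_def, volume_image, measureReal_def]
  have h4 : volume.real (g ⁻¹' W ∩ W) = volume.real (W ∩ g '' W) := by
    rw [measureReal_def, ← volume_image g, image_inter g.injective,
      image_preimage_eq _ g.surjective, measureReal_def]
  rw [measureReal_symmDiff_preimage g hW hfin, h4]
  linarith

lemma lintegral_volume_inter_translate {n : ℕ} {V W : Set (EucSp n)} (hV : MeasurableSet V)
    (hW : MeasurableSet W) :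
    ∫⁻ t : EucSp n, volume (V ∩ (fun x => x + t) ⁻¹' W) = volume V * volume W := by
  have h1 : ∀ t : EucSp n, volume (V ∩ (fun x => x + t) ⁻¹' W)
      = ∫⁻ x, V.indicator 1 x * W.indicator 1 (x + t) := fun t => by
    rw [← lintegral_indicator_one (hV.inter (hW.preimage (measurable_add_const t)))]
    refine lintegral_congr fun x => ?_
    by_cases h : x ∈ V <;> by_cases h' : x + t ∈ W <;> simp [h, h']
  have hWm : Measurable (W.indicator (1 : EucSp n → ENNReal)) := measurable_one.indicator hW
  have hVm : Measurable (V.indicator (1 : EucSp n → ENNReal)) := measurable_one.indicator hV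
  simp_rw [h1]
  rw [lintegral_lintegral_swap (by fun_prop)]
  have h2 : ∀ x : EucSp n, ∫⁻ t, V.indicator 1 x * W.indicator 1 (x + t)
      = V.indicator 1 x * volume W := fun x => by
    rw [lintegral_const_mul _ (by fun_prop),
      lintegral_add_left_eq_self (fun t => W.indicator (1 : EucSp n → ENNReal) t) x,
      lintegral_indicator_one hW]
  simp_rw [h2]
  rw [lintegral_mul_const _ hVm, lintegral_indicator_one hV]

lemma translate_preimage_eq {n : ℕ} (t : EucSp n) (W : Set (EucSp n)) :
    (fun x => x + t) ⁻¹' W = IsometryEquiv.addRight t ⁻¹' W := rfl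

lemma finite_pow {G : Type*} [Monoid G] {T : Set G} (hT : T.Finite) (k : ℕ) : (T ^ k).Finite := by
  induction k with
  | zero => simp
  | succ k ih => rw [pow_succ]; exact ih.mul hT

/-- Sets of small measure grow by a definite factor under the small moves. -/
lemma exists_growth_of_small {n : ℕ} (hn : 3 ≤ n) : ∃ c : ℝ, 0 < c ∧ ∀ τ : ℝ, 0 < τ →
    ∀ W : Set (EucSp n), MeasurableSet W → volume W ≠ ⊤ →
      volume.real W < 3 / 4 * volume.real (Metric.ball (0 : EucSp n) (τ / 20)) →
        (1 + c) * volume.real W ≤ volume.real (spread (smallMoves n τ) W) := by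
  set K : ℝ := (growthConst n : ℝ) with hK
  have hK0 : 0 ≤ K := Nat.cast_nonneg _
  refine ⟨1 / (32 * (K + 1) ^ 2), by positivity, fun τ hτ W hW hfin hsmall => ?_⟩
  by_contra! hlt
  set c : ℝ := 1 / (32 * (K + 1) ^ 2) with hc
  have hc0 : 0 < c := by positivity
  set w := volume.real W with hw
  have hw0 : 0 < w := by
    rcases (measureReal_nonneg (μ := volume) (s := W)).lt_or_eq with h | h
    · exact h
    · rw [← hw] at h
      rw [← h, mul_zero] at hlt
      exact absurd hlt (not_lt.2 measureReal_nonneg)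
  have hsq : √(2 * c) = 1 / (4 * (K + 1)) := by
    rw [Real.sqrt_eq_iff_mul_self_eq (by positivity) (by positivity), hc]
    field_simp
    norm_num
  have hinter : ∀ t ∈ Metric.ball (0 : EucSp n) (τ / 20),
      ENNReal.ofReal (3 / 4 * w) ≤ volume (W ∩ (fun x => x + t) ⁻¹' W) := fun t ht => by
    have h1 := volume_translate_symmDiff_le_of_growth hn hτ hW hfin (η := c * w)
      (by rw [← hw]; linarith) t
    have h2 := measureReal_symmDiff_preimage (IsometryEquiv.addRight t) hW hfin
    rw [translate_preimage_eq, h2, ← hw, ← mul_assoc 2 c, Real.sqrt_mul (by positivity), hsq,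
      mul_assoc (1 / (4 * (K + 1))), ← hK, Real.mul_self_sqrt hw0.le] at h1
    rw [mem_ball_zero_iff] at ht
    have h3 : (2 * Real.pi * ‖t‖ / τ) ^ 2 ≤ 1 / 4 := by
      have : 2 * Real.pi * ‖t‖ / τ ≤ 1 / 2 := by
        rw [div_le_iff₀ hτ]
        nlinarith [Real.pi_le_four, Real.pi_pos, norm_nonneg t]
      have h0 : 0 ≤ 2 * Real.pi * ‖t‖ / τ := by positivity
      nlinarith
    have h4 : K * (1 / (4 * (K + 1)) * w) ≤ 1 / 4 * w := by
      rw [← mul_assoc]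
      gcongr
      rw [mul_one_div, div_le_iff₀ (by positivity)]
      linarith
    have h5 : 3 / 4 * w ≤ volume.real (IsometryEquiv.addRight t ⁻¹' W ∩ W) := by
      nlinarith
    rw [inter_comm, translate_preimage_eq]
    exact ENNReal.ofReal_le_of_le_toReal h5
  have hint : ENNReal.ofReal (3 / 4 * w) * volume (Metric.ball (0 : EucSp n) (τ / 20))
      ≤ volume W * volume W := by
    rw [← lintegral_volume_inter_translate hW hW, ← setLIntegral_const]
    exact (setLIntegral_mono' measurableSet_ball hinter).trans (setLIntegral_le_lintegral _ _)
  have h6 := ENNReal.toReal_mono (ENNReal.mul_ne_top hfin hfin) hint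
  rw [ENNReal.toReal_mul, ENNReal.toReal_mul, ENNReal.toReal_ofReal (by positivity)] at h6
  change 3 / 4 * w * volume.real (Metric.ball (0 : EucSp n) (τ / 20)) ≤ w * w at h6
  nlinarith

lemma volume_spread_ne_top {n : ℕ} {T : Set (EucSp n ≃ᵢ EucSp n)} (hT : T.Finite)
    {U : Set (EucSp n)} (hU : volume U ≠ ⊤) : volume (spread T U) ≠ ⊤ :=
  (measure_biUnion_lt_top hT fun g _ => by rw [volume_image]; exact hU.lt_top).ne

lemma volume_spread_pow_ge {n : ℕ} {c τ m : ℝ} (hc : 0 ≤ c) (hm : ∀ W : Set (EucSp n),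
      MeasurableSet W → volume W ≠ ⊤ → volume.real W < m →
        (1 + c) * volume.real W ≤ volume.real (spread (smallMoves n τ) W))
    {U : Set (EucSp n)} (hU : MeasurableSet U) (hfin : volume U ≠ ⊤) (k : ℕ) :
    min ((1 + c) ^ k * volume.real U) m ≤ volume.real (spread (smallMoves n τ ^ k) U) := by
  have hT := finite_smallMoves n τ
  have hTpow := finite_pow hT
  induction k with
  | zero => simp [spread_one]
  | succ k ih =>
    rw [spread_pow_succ]
    set W := spread (smallMoves n τ ^ k) U with hW
    have hWfin : volume W ≠ ⊤ := volume_spread_ne_top (hTpow k) hfin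
    have hWm : MeasurableSet W := measurableSet_spread (hTpow k) hU
    by_cases h : volume.real W < m
    · refine le_trans ?_ (hm W hWm hWfin h)
      have ih' : (1 + c) ^ k * volume.real U ≤ volume.real W := by
        rcases min_le_iff.1 ih with h' | h'
        · exact h'
        · linarith
      refine (min_le_left _ _).trans ?_
      rw [pow_succ', mul_assoc]
      gcongr
    · refine (min_le_right _ _).trans ((not_lt.1 h).trans ?_)
      exact measureReal_mono (subset_spread (one_mem_smallMoves n τ) W)
        (volume_spread_ne_top hT hWfin)

/-- Small subsets of a bounded set can be doubled inside a set with nonempty interior. -/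
lemma exists_doubling_of_small {n : ℕ} (hn : 3 ≤ n) (R : ℝ) {B : Set (EucSp n)}
    (hB : (interior B).Nonempty) (hBfin : volume B ≠ ⊤) :
    ∃ T : Set (EucSp n ≃ᵢ EucSp n), T.Finite ∧ ∃ ε : ℝ, 0 < ε ∧
      ∀ U ⊆ Metric.closedBall (0 : EucSp n) R, MeasurableSet U → volume.real U ≤ ε →
        2 * volume.real U ≤ volume.real (spread T U ∩ B) := by
  obtain ⟨c, hc, hgrow⟩ := exists_growth_of_small hn
  obtain ⟨y, hy⟩ := hB
  obtain ⟨ρ, hρ, hyB⟩ := Metric.isOpen_iff.1 isOpen_interior y hy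
  obtain ⟨X, -, hXf, hX⟩ := (isCompact_closedBall (0 : EucSp n) (R + 1)).finite_cover_balls hρ
  obtain ⟨k, hk⟩ := pow_unbounded_of_one_lt (2 * X.ncard : ℝ) (by linarith : 1 < 1 + c)
  set τ : ℝ := 1 / (k + 1) with hτ
  have hτ0 : 0 < τ := by positivity
  set m : ℝ := 3 / 4 * volume.real (Metric.ball (0 : EucSp n) (τ / 20)) with hm
  have hm0 : 0 < m := by
    have : 0 < volume.real (Metric.ball (0 : EucSp n) (τ / 20)) :=
      ENNReal.toReal_pos (Metric.measure_ball_pos _ _ (by positivity)).ne' measure_ball_lt_top.ne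
    positivity
  have hfinS := finite_pow (finite_smallMoves n τ) k
  refine ⟨(fun x => IsometryEquiv.addRight (y - x)) '' X * smallMoves n τ ^ k,
    (hXf.image _).mul hfinS, m / (1 + c) ^ k, by positivity, fun U hU hUm hUε => ?_⟩
  have hUfin : volume U ≠ ⊤ := ((measure_mono hU).trans_lt measure_closedBall_lt_top).ne
  have h1 := volume_spread_pow_ge hc.le (hgrow τ hτ0) hUm hUfin k
  rw [le_div_iff₀ (by positivity), mul_comm] at hUε
  rw [min_eq_left hUε] at h1
  set W := spread (smallMoves n τ ^ k) U with hW
  have hWfin : volume W ≠ ⊤ := volume_spread_ne_top hfinS hUfin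
  have hWball : W ⊆ Metric.closedBall 0 (R + 1) := by
    refine (spread_smallMoves_pow_subset hτ0.le hU k).trans (Metric.closedBall_subset_closedBall ?_)
    have : (k : ℝ) * τ ≤ 1 := by
      rw [hτ, mul_one_div, div_le_one (by positivity)]; linarith
    linarith
  rw [spread_mul]
  set D := spread ((fun x => IsometryEquiv.addRight (y - x)) '' X) W ∩ B with hD
  have hDfin : volume D ≠ ⊤ := ((measure_mono inter_subset_right).trans_lt hBfin.lt_top).ne
  have hpiece : ∀ x ∈ hXf.toFinset, volume.real (W ∩ Metric.ball x ρ) ≤ volume.real D := by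
    intro x hx
    have hx' : x ∈ X := hXf.mem_toFinset.1 hx
    have : (IsometryEquiv.addRight (y - x)) '' (W ∩ Metric.ball x ρ) ⊆ D := by
      rintro _ ⟨z, ⟨hz, hzx⟩, rfl⟩
      refine ⟨mem_spread.2 ⟨_, mem_image_of_mem _ hx', z, hz, rfl⟩,
        interior_subset (hyB ?_)⟩
      rw [Metric.mem_ball, dist_eq_norm] at hzx ⊢
      rw [IsometryEquiv.addRight_apply]
      convert hzx using 2
      abel
    rw [measureReal_def, ← volume_image (IsometryEquiv.addRight (y - x))]
    exact ENNReal.toReal_mono hDfin (measure_mono this)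
  have hcover : W ⊆ ⋃ x ∈ hXf.toFinset, W ∩ Metric.ball x ρ := by
    intro z hz
    obtain ⟨x, hx, hzx⟩ := mem_iUnion₂.1 (hX (hWball hz))
    exact mem_iUnion₂.2 ⟨x, hXf.mem_toFinset.2 hx, hz, hzx⟩
  have h2 : volume.real W ≤ X.ncard * volume.real D := by
    refine (measureReal_mono hcover ?_).trans ((measureReal_biUnion_finset_le _ _).trans ?_)
    · exact (measure_mono (iUnion₂_subset fun _ _ => inter_subset_left)).trans_lt
        hWfin.lt_top |>.ne
    · refine (Finset.sum_le_sum hpiece).trans ?_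
      rw [Finset.sum_const, nsmul_eq_mul, ← Set.ncard_eq_toFinset_card X hXf]
  have hXpos : 0 ≤ volume.real D := measureReal_nonneg
  by_cases hX0 : (X.ncard : ℝ) = 0
  · rw [hX0, zero_mul] at h2
    have h3 : (1 + c) ^ k * volume.real U ≤ 0 := h1.trans h2
    have h4 : volume.real U ≤ 0 := by
      by_contra! h; exact absurd h3 (not_le.2 (by positivity))
    linarith
  · have hXpos' : (0 : ℝ) < X.ncard := lt_of_le_of_ne (Nat.cast_nonneg _) (Ne.symm hX0)
    have h3 : 2 * X.ncard * volume.real U ≤ X.ncard * volume.real D :=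
      (mul_le_mul_of_nonneg_right hk.le measureReal_nonneg).trans (h1.trans h2)
    have h4 : X.ncard * (2 * volume.real U) ≤ X.ncard * volume.real D := by linarith
    exact le_of_mul_le_mul_left h4 hXpos'

lemma exists_small_increment {a : ℕ → ℝ} {M : ℝ} {k : ℕ} (h0 : 0 ≤ a 0) (hM : a (k + 1) ≤ M) :
    ∃ j < k + 1, a (j + 1) ≤ a j + M * (1 / (k + 1)) := by
  by_contra! h
  have h1 := Finset.sum_lt_sum_of_nonempty (s := Finset.range (k + 1)) ⟨0, by simp⟩
    (f := fun _ => M * (1 / (k + 1))) (g := fun j => a (j + 1) - a j)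
    fun j hj => by linarith [h j (Finset.mem_range.1 hj)]
  rw [Finset.sum_range_sub, Finset.sum_const, Finset.card_range, nsmul_eq_mul] at h1
  push_cast at h1
  have : ((k : ℝ) + 1) * (M * (1 / (k + 1))) = M := by field_simp
  linarith

/-- Uniformly over large subsets of a ball, finitely many isometries spread each of them over
most of a bounded set. -/
lemma exists_cover_of_large {n : ℕ} (hn : 3 ≤ n) {R : ℝ} {B : Set (EucSp n)}
    (hBR : B ⊆ Metric.closedBall 0 R) (hBm : MeasurableSet B) {ε : ℝ} (hε : 0 < ε) :
    ∃ T : Set (EucSp n ≃ᵢ EucSp n), T.Finite ∧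
      ∀ U ⊆ Metric.closedBall (0 : EucSp n) R, MeasurableSet U → ε ≤ volume.real U →
        2 / 3 * volume.real B ≤ volume.real (spread T U ∩ B) := by
  have hBfin : volume B ≠ ⊤ := ((measure_mono hBR).trans_lt measure_closedBall_lt_top).ne
  rcases (measureReal_nonneg (μ := volume) (s := B)).eq_or_lt with hb | hb
  · exact ⟨∅, finite_empty, fun U _ _ _ => by rw [← hb, mul_zero]; exact measureReal_nonneg⟩
  set b := volume.real B with hbdef
  have hR : 0 ≤ R := by
    by_contra! h
    rw [Metric.closedBall_eq_empty.2 h, subset_empty_iff] at hBR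
    rw [hbdef, hBR, measureReal_empty] at hb
    exact lt_irrefl _ hb
  set K : ℝ := (growthConst n : ℝ) with hK
  set M : ℝ := volume.real (Metric.closedBall (0 : EucSp n) (R + 1)) with hM
  have hM0 : 0 ≤ M := measureReal_nonneg
  set Q : ℝ := volume.real (Metric.closedBall (0 : EucSp n) (2 * R + 1)) with hQ
  have hQ0 : 0 < Q := ENNReal.toReal_pos
    (Metric.measure_closedBall_pos _ _ (by linarith)).ne' measure_closedBall_lt_top.ne
  set β : ℝ := b / 3 * ε / Q with hβ
  have hβ0 : 0 < β := by positivity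
  obtain ⟨k, hk⟩ : ∃ k : ℕ, K * (√(2 * (M * (1 / ((k : ℝ) + 1)))) * √M) < β / 2 := by
    have h : Filter.Tendsto (fun k : ℕ => K * (√(2 * (M * (1 / ((k : ℝ) + 1)))) * √M))
        Filter.atTop (nhds (K * (√(2 * (M * 0)) * √M))) :=
      (((tendsto_one_div_add_atTop_nhds_zero_nat.const_mul M).const_mul 2).sqrt.mul_const
        √M).const_mul K
    simp only [mul_zero, Real.sqrt_zero, zero_mul] at h
    exact (h.eventually_lt_const (by positivity)).exists
  set τ : ℝ := 1 / ((k : ℝ) + 1) with hτ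
  have hτ0 : 0 < τ := by positivity
  obtain ⟨δ, hδ, hδM⟩ : ∃ δ > 0, (2 * Real.pi * δ / τ) ^ 2 * M < β / 2 := by
    have h : Filter.Tendsto (fun δ : ℝ => (2 * Real.pi * δ / τ) ^ 2 * M) (nhds 0) (nhds 0) :=
      (by fun_prop : Continuous fun δ : ℝ => (2 * Real.pi * δ / τ) ^ 2 * M).tendsto' _ _ (by simp)
    have h' := (h.eventually_lt_const (u := β / 2) (by positivity)).filter_mono
      (nhdsWithin_le_nhds (s := Ioi 0))
    obtain ⟨δ, hδ, hδ'⟩ := (h'.and self_mem_nhdsWithin).exists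
    exact ⟨δ, hδ', hδ⟩
  obtain ⟨X, -, hXf, hX⟩ :=
    (isCompact_closedBall (0 : EucSp n) (2 * R + 1)).finite_cover_balls hδ
  have hTf := finite_smallMoves n τ
  refine ⟨(fun x => (IsometryEquiv.addRight x).symm) '' X * smallMoves n τ ^ (k + 1),
    (hXf.image _).mul (finite_pow hTf _), fun U hUR hU hUε => ?_⟩
  have hUfin : volume U ≠ ⊤ := ((measure_mono hUR).trans_lt measure_closedBall_lt_top).ne
  set W : ℕ → Set (EucSp n) := fun j => spread (smallMoves n τ ^ j) U with hW
  have hWfin : ∀ j, volume (W j) ≠ ⊤ := fun j => volume_spread_ne_top (finite_pow hTf j) hUfin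
  have hWm : ∀ j, MeasurableSet (W j) := fun j => measurableSet_spread (finite_pow hTf j) hU
  have hWball : ∀ j ≤ k + 1, W j ⊆ Metric.closedBall 0 (R + 1) := fun j hj => by
    refine (spread_smallMoves_pow_subset hτ0.le hUR j).trans
      (Metric.closedBall_subset_closedBall ?_)
    have hj' : (j : ℝ) ≤ k + 1 := by exact_mod_cast hj
    have : (j : ℝ) * τ ≤ 1 := by
      rw [hτ, mul_one_div, div_le_one (by positivity)]; exact hj'
    linarith
  have hWM : ∀ j ≤ k + 1, volume.real (W j) ≤ M := fun j hj =>
    measureReal_mono (hWball j hj) measure_closedBall_lt_top.ne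
  obtain ⟨j, hj, hjle⟩ := exists_small_increment (a := fun j => volume.real (W j))
    measureReal_nonneg (hWM (k + 1) le_rfl)
  have hinv := volume_translate_symmDiff_le_of_growth hn hτ0 (hWm j) (hWfin j)
    (η := M * (1 / ((k : ℝ) + 1))) (by
      have e : spread (smallMoves n τ) (W j) = W (j + 1) := (spread_pow_succ _ _ _).symm
      rw [e]; exact hjle)
  have hinv' : ∀ t : EucSp n, ‖t‖ ≤ δ →
      volume.real (symmDiff ((fun x => x + t) ⁻¹' W j) (W j)) < β := fun t ht => by
    refine (hinv t).trans_lt ?_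
    have h1 : (2 * Real.pi * ‖t‖ / τ) ^ 2 * volume.real (W j)
        ≤ (2 * Real.pi * δ / τ) ^ 2 * M := by
      gcongr
      exact hWM j hj.le
    have h2 : K * (√(2 * (M * (1 / ((k : ℝ) + 1)))) * √(volume.real (W j)))
        ≤ K * (√(2 * (M * (1 / ((k : ℝ) + 1)))) * √M) := by
      gcongr
      exact hWM j hj.le
    linarith
  have hUW : U ⊆ W j := subset_spread (one_mem_pow (one_mem_smallMoves n τ) j) U
  have hεW : ε ≤ volume.real (W j) := hUε.trans (measureReal_mono hUW (hWfin j))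
  set G := spread ((fun x => (IsometryEquiv.addRight x).symm) '' X
    * smallMoves n τ ^ (k + 1)) U with hG
  have hGm : MeasurableSet G := measurableSet_spread ((hXf.image _).mul (finite_pow hTf _)) hU
  have hGW : ∀ t ∈ X, (fun x => x + t) ⁻¹' W j ⊆ G := fun t ht x hx => by
    rw [hG, spread_mul]
    refine mem_spread.2 ⟨_, mem_image_of_mem _ ht, x + t,
      spread_pow_mono (one_mem_smallMoves n τ) hj.le U hx, ?_⟩
    exact (IsometryEquiv.addRight t).symm_apply_apply x
  by_contra! hlt
  set V := B \ G with hV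
  have hVm : MeasurableSet V := hBm.diff hGm
  have hVfin : volume V ≠ ⊤ := ((measure_mono sdiff_subset).trans_lt hBfin.lt_top).ne
  have hVb : b / 3 < volume.real V := by
    have := measureReal_sdiff_add_inter (μ := volume) (s := B) hGm hBfin
    rw [inter_comm] at this
    linarith
  have hsmall : ∀ t : EucSp n, ‖t‖ ≤ 2 * R + 1 →
      volume (V ∩ (fun x => x + t) ⁻¹' W j) ≤ ENNReal.ofReal β := fun t ht => by
    obtain ⟨t', ht', htt'⟩ := mem_iUnion₂.1 (hX (mem_closedBall_zero_iff.2 ht))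
    have hsub : V ∩ (fun x => x + t) ⁻¹' W j
        ⊆ (fun x => x + t') ⁻¹' symmDiff ((fun x => x + (t - t')) ⁻¹' W j) (W j) := by
      rintro x ⟨hxV, hxW⟩
      refine Or.inl ⟨?_, fun h => hxV.2 (hGW t' ht' h)⟩
      change x + t' + (t - t') ∈ W j
      rw [add_assoc, add_sub_cancel]
      exact hxW
    refine (measure_mono hsub).trans ?_
    rw [translate_preimage_eq t', volume_preimage]
    refine ENNReal.le_ofReal_iff_toReal_le ?_ hβ0.le |>.2 (hinv' _ ?_).le
    · refine ((measure_mono symmDiff_subset_union).trans_lt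
        (measure_union_lt_top ?_ (hWfin j).lt_top)).ne
      rw [translate_preimage_eq, volume_preimage]
      exact (hWfin j).lt_top
    · rw [← dist_eq_norm]; exact (Metric.mem_ball.1 htt').le
  have hzero : ∀ t : EucSp n, t ∉ Metric.closedBall (0 : EucSp n) (2 * R + 1) →
      volume (V ∩ (fun x => x + t) ⁻¹' W j) = 0 := fun t ht => by
    have : V ∩ (fun x => x + t) ⁻¹' W j = ∅ := by
      refine eq_empty_of_forall_notMem fun x hx => ht ?_
      have h1 := mem_closedBall_zero_iff.1 (hBR hx.1.1)
      have h2 := mem_closedBall_zero_iff.1 (hWball j hj.le hx.2)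
      rw [mem_closedBall_zero_iff]
      have h3 := norm_sub_le (x + t) x
      rw [add_sub_cancel_left] at h3
      linarith
    rw [this, measure_empty]
  have hint : volume V * volume (W j)
      ≤ ENNReal.ofReal β * volume (Metric.closedBall (0 : EucSp n) (2 * R + 1)) := by
    rw [← lintegral_volume_inter_translate hVm (hWm j), ← setLIntegral_const,
      ← lintegral_indicator measurableSet_closedBall]
    refine lintegral_mono fun t => ?_
    by_cases ht : t ∈ Metric.closedBall (0 : EucSp n) (2 * R + 1)
    · rw [indicator_of_mem ht]; exact hsmall t (mem_closedBall_zero_iff.1 ht)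
    · rw [hzero t ht]; exact zero_le
  have h6 := ENNReal.toReal_mono
    (ENNReal.mul_ne_top ENNReal.ofReal_ne_top measure_closedBall_lt_top.ne) hint
  rw [ENNReal.toReal_mul, ENNReal.toReal_mul, ENNReal.toReal_ofReal hβ0.le] at h6
  change volume.real V * volume.real (W j) ≤ β * Q at h6
  have h7 : β * Q = b / 3 * ε := by rw [hβ]; field_simp
  have h8 : b / 3 * ε < volume.real V * volume.real (W j) := by
    have : 0 < volume.real V := by linarith [show 0 < b / 3 by positivity]
    calc b / 3 * ε < volume.real V * ε := by gcongr
      _ ≤ _ := by gcongr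
  linarith

/-- **Expansion**: finitely many isometries expand every measurable subset of a bounded set
inside a bounded set with nonempty interior. -/
theorem exists_expansion {n : ℕ} (hn : 3 ≤ n) {A B : Set (EucSp n)} (hA : Bornology.IsBounded A)
    (hB : Bornology.IsBounded B) (hBm : MeasurableSet B) (hBi : (interior B).Nonempty) :
    ∃ T : Set (EucSp n ≃ᵢ EucSp n), T.Finite ∧ ∀ U ⊆ A, MeasurableSet U →
      min (2 * volume.real U) (2 / 3 * volume.real B) ≤ volume.real (spread T U ∩ B) := by
  obtain ⟨R, hR⟩ := (hA.union hB).subset_closedBall 0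
  have hBfin : volume B ≠ ⊤ := hB.measure_lt_top.ne
  obtain ⟨T₁, hT₁, ε, hε, h₁⟩ := exists_doubling_of_small hn R hBi hBfin
  obtain ⟨T₂, hT₂, h₂⟩ := exists_cover_of_large hn (subset_union_right.trans hR) hBm hε
  refine ⟨T₁ ∪ T₂, hT₁.union hT₂, fun U hU hUm => ?_⟩
  have hUR := hU.trans (subset_union_left.trans hR)
  have hmono : ∀ T ⊆ T₁ ∪ T₂, volume.real (spread T U ∩ B)
      ≤ volume.real (spread (T₁ ∪ T₂) U ∩ B) := fun T hT =>
    measureReal_mono (inter_subset_inter_left _ (spread_mono hT subset_rfl))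
      ((measure_mono inter_subset_right).trans_lt hBfin.lt_top).ne
  rcases le_total (volume.real U) ε with h | h
  · exact (min_le_left _ _).trans ((h₁ U hUR hUm h).trans (hmono _ subset_union_left))
  · exact (min_le_right _ _).trans ((h₂ U hUR hUm h).trans (hmono _ subset_union_right))

section Matching

variable {n : ℕ} {ι : Type*} {γ : ι → EucSp n ≃ᵢ EucSp n} {A B : Set (EucSp n)}
  {f g : EucSp n → Option ι}

/-- A measurable partial injection from `A` to `B` that moves `x` by the isometry `γ i` whenever
`f x = some i`, and is undefined where `f x = none`. -/
structure IsMatching (γ : ι → EucSp n ≃ᵢ EucSp n) (A B : Set (EucSp n))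
    (f : EucSp n → Option ι) : Prop where
  measurable : ∀ i, MeasurableSet {x | f x = some i}
  mem : ∀ {x i}, f x = some i → x ∈ A ∧ γ i x ∈ B
  inj : ∀ {x y i j}, f x = some i → f y = some j → γ i x = γ j y → x = y

/-- The set of points matched to something by `f`. -/
def matchedImage (γ : ι → EucSp n ≃ᵢ EucSp n) (f : EucSp n → Option ι) : Set (EucSp n) :=
  {y | ∃ x i, f x = some i ∧ γ i x = y}

/-- The points of `B` that are moved images of points of `X`. -/
def nbr (γ : ι → EucSp n ≃ᵢ EucSp n) (B X : Set (EucSp n)) : Set (EucSp n) :=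
  {y | y ∈ B ∧ ∃ i, ∃ x ∈ X, γ i x = y}

/-- The points reachable from `R` by at most `k` alternations along the matching `f`. -/
def altReach (γ : ι → EucSp n ≃ᵢ EucSp n) (B : Set (EucSp n)) (f : EucSp n → Option ι)
    (R : Set (EucSp n)) : ℕ → Set (EucSp n)
  | 0 => R
  | k + 1 => altReach γ B f R k ∪ {x | ∃ j, f x = some j ∧ γ j x ∈ nbr γ B (altReach γ B f R k)}

open Classical in
/-- The function `f` reassigned to the constant value `o` on `C`. -/
def reassign (f : EucSp n → Option ι) (C : Set (EucSp n)) (o : Option ι) :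
    EucSp n → Option ι := fun x => if x ∈ C then o else f x

lemma reassign_of_mem {C : Set (EucSp n)} {o : Option ι} {x : EucSp n} (h : x ∈ C) :
    reassign f C o x = o := if_pos h

lemma reassign_of_notMem {C : Set (EucSp n)} {o : Option ι} {x : EucSp n} (h : x ∉ C) :
    reassign f C o x = f x := if_neg h

lemma nbr_mono {X Y : Set (EucSp n)} (h : X ⊆ Y) : nbr γ B X ⊆ nbr γ B Y :=
  fun _ ⟨hy, i, x, hx, e⟩ => ⟨hy, i, x, h hx, e⟩

lemma nbr_subset {X : Set (EucSp n)} : nbr γ B X ⊆ B := fun _ h => h.1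

lemma altReach_mono (R : Set (EucSp n)) : Monotone (altReach γ B f R) :=
  monotone_nat_of_le_succ fun _ => subset_union_left

lemma measurableSet_nbr [Finite ι] (hB : MeasurableSet B) {X : Set (EucSp n)}
    (hX : MeasurableSet X) : MeasurableSet (nbr γ B X) := by
  have : nbr γ B X = B ∩ ⋃ i, γ i '' X := by ext; simp [nbr]
  rw [this]
  exact hB.inter (MeasurableSet.iUnion fun i => measurableSet_image _ hX)

namespace IsMatching

lemma measurableSet_pullback [Finite ι] (hf : IsMatching γ A B f) {V : Set (EucSp n)}
    (hV : MeasurableSet V) : MeasurableSet {x | ∃ j, f x = some j ∧ γ j x ∈ V} := by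
  have : {x | ∃ j, f x = some j ∧ γ j x ∈ V} = ⋃ j, {x | f x = some j} ∩ γ j ⁻¹' V := by
    ext; simp
  rw [this]
  exact MeasurableSet.iUnion fun j =>
    (hf.measurable j).inter (hV.preimage (γ j).continuous.measurable)

lemma measurableSet_none [Finite ι] (hf : IsMatching γ A B f) :
    MeasurableSet {x | f x = none} := by
  have : {x | f x = none} = (⋃ i, {x | f x = some i})ᶜ := by
    ext x; simp [Option.eq_none_iff_forall_ne_some]
  rw [this]
  exact (MeasurableSet.iUnion hf.measurable).compl

lemma measurableSet_matchedImage [Finite ι] (hf : IsMatching γ A B f) :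
    MeasurableSet (matchedImage γ f) := by
  have : matchedImage γ f = ⋃ i, γ i '' {x | f x = some i} := by
    ext y
    simp only [matchedImage, mem_ofPred_eq, mem_iUnion, mem_image]
    exact exists_comm
  rw [this]
  exact MeasurableSet.iUnion fun i => measurableSet_image _ (hf.measurable i)

lemma matchedImage_subset (hf : IsMatching γ A B f) : matchedImage γ f ⊆ B := by
  rintro _ ⟨x, i, h, rfl⟩
  exact (hf.mem h).2

lemma measurableSet_altReach [Finite ι] (hf : IsMatching γ A B f) (hB : MeasurableSet B)
    {R : Set (EucSp n)} (hR : MeasurableSet R) (k : ℕ) :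
    MeasurableSet (altReach γ B f R k) := by
  induction k with
  | zero => exact hR
  | succ k ih => exact ih.union (hf.measurableSet_pullback (measurableSet_nbr hB ih))

lemma altReach_subset (hf : IsMatching γ A B f) {R : Set (EucSp n)} (hR : R ⊆ A) (k : ℕ) :
    altReach γ B f R k ⊆ A := by
  induction k with
  | zero => exact hR
  | succ k ih => exact union_subset ih fun x ⟨j, h, _⟩ => (hf.mem h).1

lemma volume_pullback [Finite ι] (hf : IsMatching γ A B f) {V : Set (EucSp n)}
    (hV : MeasurableSet V) :
    volume {x | ∃ j, f x = some j ∧ γ j x ∈ V} = volume (matchedImage γ f ∩ V) := by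
  have e1 : {x | ∃ j, f x = some j ∧ γ j x ∈ V} = ⋃ j, {x | f x = some j} ∩ γ j ⁻¹' V := by
    ext; simp
  have e2 : matchedImage γ f ∩ V = ⋃ j, γ j '' ({x | f x = some j} ∩ γ j ⁻¹' V) := by
    ext y
    simp only [matchedImage, mem_inter_iff, mem_ofPred_eq, mem_iUnion, mem_image, mem_preimage]
    constructor
    · rintro ⟨⟨x, i, h, rfl⟩, hy⟩
      exact ⟨i, x, ⟨h, hy⟩, rfl⟩
    · rintro ⟨i, x, ⟨h, hy⟩, rfl⟩
      exact ⟨⟨x, i, h, rfl⟩, hy⟩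
  have hm : ∀ j, MeasurableSet ({x | f x = some j} ∩ γ j ⁻¹' V) := fun j =>
    (hf.measurable j).inter (hV.preimage (γ j).continuous.measurable)
  rw [e1, e2, measure_iUnion ?_ hm, measure_iUnion ?_ fun j => measurableSet_image _ (hm j)]
  · simp_rw [volume_image]
  · intro i j hij
    refine Set.disjoint_left.2 ?_
    rintro _ ⟨x, ⟨hx, -⟩, rfl⟩ ⟨y, ⟨hy, -⟩, e⟩
    have := hf.inj hy hx e
    subst this
    exact hij (Option.some_injective _ (hx.symm.trans hy))
  · intro i j hij
    refine Set.disjoint_left.2 ?_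
    rintro x ⟨hx, -⟩ ⟨hy, -⟩
    exact hij (Option.some_injective _ (hx.symm.trans hy))

lemma volume_unmatched [Finite ι] (hf : IsMatching γ A B f)
    (hAB : volume A = volume B) (hfin : volume A ≠ ⊤) :
    volume (A ∩ {x | f x = none}) = volume (B \ matchedImage γ f) := by
  have h := hf.volume_pullback MeasurableSet.univ
  simp only [mem_univ, and_true, inter_univ] at h
  have h1 : A \ {x | f x = none} = {x | ∃ j, f x = some j} := by
    ext x
    rw [Set.mem_sdiff, mem_ofPred_eq, mem_ofPred_eq, ← ne_eq, Option.ne_none_iff_exists']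
    exact ⟨fun h => h.2, fun ⟨j, h⟩ => ⟨(hf.mem h).1, j, h⟩⟩
  have h2 := measure_inter_add_sdiff (μ := volume) A hf.measurableSet_none
  have h3 := measure_inter_add_sdiff (μ := volume) B hf.measurableSet_matchedImage
  rw [inter_eq_self_of_subset_right hf.matchedImage_subset] at h3
  rw [h1, h] at h2
  have hne : volume (matchedImage γ f) ≠ ⊤ :=
    ((measure_mono hf.matchedImage_subset).trans_lt (hAB ▸ hfin.lt_top)).ne
  rw [add_comm, hAB, ← h3] at h2
  exact (ENNReal.add_right_inj hne).1 h2

lemma assign (hf : IsMatching γ A B f) {C : Set (EucSp n)} (hC : MeasurableSet C) {i : ι}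
    (hCA : C ⊆ A) (hCB : γ i '' C ⊆ B) (hCf : Disjoint (γ i '' C) (matchedImage γ f)) :
    IsMatching γ A B (reassign f C (some i)) where
  measurable j := by
    have : {x | reassign f C (some i) x = some j}
        = (C ∩ {_x | i = j}) ∪ (Cᶜ ∩ {x | f x = some j}) := by
      ext x
      by_cases hx : x ∈ C <;> simp [reassign, hx]
    rw [this]
    exact (hC.inter (MeasurableSet.const _)).union (hC.compl.inter (hf.measurable j))
  mem {x j} h := by
    by_cases hx : x ∈ C
    · rw [reassign_of_mem hx, Option.some_inj] at h
      exact h ▸ ⟨hCA hx, hCB (mem_image_of_mem _ hx)⟩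
    · rw [reassign_of_notMem hx] at h
      exact hf.mem h
  inj {x y j k} hj hk e := by
    by_cases hx : x ∈ C <;> by_cases hy : y ∈ C
    · rw [reassign_of_mem hx, Option.some_inj] at hj
      rw [reassign_of_mem hy, Option.some_inj] at hk
      subst hj hk
      exact (γ i).injective e
    · rw [reassign_of_mem hx, Option.some_inj] at hj
      rw [reassign_of_notMem hy] at hk
      subst hj
      exact (Set.disjoint_left.1 hCf (mem_image_of_mem _ hx) ⟨y, k, hk, e.symm⟩).elim
    · rw [reassign_of_notMem hx] at hj
      rw [reassign_of_mem hy, Option.some_inj] at hk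
      subst hk
      exact (Set.disjoint_left.1 hCf (mem_image_of_mem _ hy) ⟨x, j, hj, e⟩).elim
    · rw [reassign_of_notMem hx] at hj
      rw [reassign_of_notMem hy] at hk
      exact hf.inj hj hk e

lemma erase (hf : IsMatching γ A B f) {C : Set (EucSp n)} (hC : MeasurableSet C) :
    IsMatching γ A B (reassign f C none) := by
  have key : ∀ {x j}, reassign f C none x = some j → f x = some j := fun {x j} h => by
    by_cases hx : x ∈ C
    · simp [reassign_of_mem hx] at h
    · rwa [reassign_of_notMem hx] at h
  refine ⟨fun j => ?_, fun h => hf.mem (key h), fun h h' => hf.inj (key h) (key h')⟩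
  have : {x | reassign f C none x = some j} = Cᶜ ∩ {x | f x = some j} := by
    ext x
    by_cases hx : x ∈ C <;> simp [reassign, hx]
  rw [this]
  exact hC.compl.inter (hf.measurable j)

end IsMatching

lemma matchedImage_assign {C : Set (EucSp n)} (i : ι) (hC : ∀ x ∈ C, f x = none) :
    matchedImage γ (reassign f C (some i)) = matchedImage γ f ∪ γ i '' C := by
  ext y
  constructor
  · rintro ⟨x, j, h, rfl⟩
    by_cases hx : x ∈ C
    · rw [reassign_of_mem hx, Option.some_inj] at h
      exact Or.inr (h ▸ mem_image_of_mem _ hx)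
    · rw [reassign_of_notMem hx] at h
      exact Or.inl ⟨x, j, h, rfl⟩
  · rintro (⟨x, j, h, rfl⟩ | ⟨x, hx, rfl⟩)
    · have hx : x ∉ C := fun hx => by simp [hC x hx] at h
      exact ⟨x, j, by rw [reassign_of_notMem hx, h], rfl⟩
    · exact ⟨x, i, reassign_of_mem hx, rfl⟩

lemma IsMatching.matchedImage_erase (hf : IsMatching γ A B f) {C : Set (EucSp n)} {j : ι}
    (hC : ∀ x ∈ C, f x = some j) :
    matchedImage γ (reassign f C none) = matchedImage γ f \ γ j '' C := by
  ext y
  constructor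
  · rintro ⟨x, i, h, rfl⟩
    have hx : x ∉ C := fun hx => by simp [reassign_of_mem hx] at h
    rw [reassign_of_notMem hx] at h
    refine ⟨⟨x, i, h, rfl⟩, ?_⟩
    rintro ⟨z, hz, e⟩
    exact hx (hf.inj (hC z hz) h e ▸ hz)
  · rintro ⟨⟨x, i, h, rfl⟩, hy⟩
    have hx : x ∉ C := fun hx => hy ⟨x, hx, by
      rw [Option.some_injective _ (h.symm.trans (hC x hx))]⟩
    exact ⟨x, i, by rw [reassign_of_notMem hx, h], rfl⟩

lemma altReach_erase_subset (R C : Set (EucSp n)) (k : ℕ) :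
    altReach γ B (reassign f C none) R k ⊆ altReach γ B f R k := by
  induction k with
  | zero => exact subset_rfl
  | succ k ih =>
    refine union_subset_union ih ?_
    rintro x ⟨j, h, hx⟩
    have hxC : x ∉ C := fun hxC => by simp [reassign_of_mem hxC] at h
    rw [reassign_of_notMem hxC] at h
    exact ⟨j, h, nbr_mono ih hx⟩

lemma subset_altReach_erase {R C : Set (EucSp n)} {k : ℕ}
    (h : Disjoint C (altReach γ B f R k)) :
    altReach γ B f R k ⊆ altReach γ B (reassign f C none) R k := by
  induction k with
  | zero => exact subset_rfl
  | succ k ih =>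
    have ih' := ih (h.mono_right subset_union_left)
    rintro x (hx | ⟨j, hj, hx⟩)
    · exact Or.inl (ih' hx)
    · have hxC : x ∉ C := fun hxC => Set.disjoint_left.1 h hxC (Or.inr ⟨j, hj, hx⟩)
      exact Or.inr ⟨j, by rw [reassign_of_notMem hxC, hj], nbr_mono ih' hx⟩

/-- A set of unmatched points of positive measure reachable in `k` alternations can be
augmented along, at a cost at most `k + 1` times the gain. -/
theorem IsMatching.exists_augmentation [Finite ι] (hB : MeasurableSet B) {R : Set (EucSp n)}
    (hRA : R ⊆ A) (hR : MeasurableSet R) (k : ℕ) :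
    ∀ {f : EucSp n → Option ι}, IsMatching γ A B f → (∀ x ∈ R, f x = none) →
    ∀ {Z : Set (EucSp n)}, MeasurableSet Z → Z ⊆ nbr γ B (altReach γ B f R k) →
    Disjoint Z (matchedImage γ f) → volume Z ≠ 0 →
    ∃ f' Z', IsMatching γ A B f' ∧ MeasurableSet Z' ∧ Z' ⊆ Z ∧ volume Z' ≠ 0 ∧
      {x | f' x ≠ f x} ⊆ altReach γ B f R k ∧ matchedImage γ f' = matchedImage γ f ∪ Z' ∧
      volume {x | f' x ≠ f x} ≤ (k + 1) * volume Z' := by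
  induction k with
  | zero =>
    intro f hf hRf Z hZ hZN hZf hZ0
    obtain ⟨i, hi⟩ : ∃ i, volume (γ i '' (R ∩ γ i ⁻¹' Z)) ≠ 0 := by
      by_contra! h
      refine hZ0 (measure_mono_null ?_ (measure_iUnion_null h))
      intro y hy
      obtain ⟨-, i, x, hx, rfl⟩ := hZN hy
      exact mem_iUnion.2 ⟨i, x, ⟨hx, hy⟩, rfl⟩
    set C := R ∩ γ i ⁻¹' Z with hC
    have hCm : MeasurableSet C := hR.inter (hZ.preimage (γ i).continuous.measurable)
    have hCZ : γ i '' C ⊆ Z := by rintro _ ⟨x, hx, rfl⟩; exact hx.2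
    have hsub : {x | reassign f C (some i) x ≠ f x} ⊆ C := fun x hx => by
      by_contra h
      exact hx (reassign_of_notMem h)
    refine ⟨reassign f C (some i), γ i '' C, hf.assign hCm (inter_subset_left.trans hRA)
      (hCZ.trans (hZN.trans nbr_subset)) (hZf.mono_left hCZ), measurableSet_image _ hCm, hCZ, hi,
      hsub.trans inter_subset_left, matchedImage_assign i fun x hx => hRf x hx.1, ?_⟩
    rw [Nat.cast_zero, zero_add, one_mul, volume_image]
    exact measure_mono hsub
  | succ k ih =>
    intro f hf hRf Z hZ hZN hZf hZ0
    set X := altReach γ B f R k with hX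
    have hXm : MeasurableSet X := hf.measurableSet_altReach hB hR k
    have hNm : MeasurableSet (nbr γ B X) := measurableSet_nbr hB hXm
    by_cases hcase : volume (Z ∩ nbr γ B X) = 0
    swap
    · obtain ⟨f', Z', h1, h2, h3, h4, h5, h6, h7⟩ := ih hf hRf (hZ.inter hNm) inter_subset_right
        (hZf.mono_left inter_subset_left) hcase
      refine ⟨f', Z', h1, h2, h3.trans inter_subset_left, h4, h5.trans subset_union_left, h6,
        h7.trans ?_⟩
      gcongr
      exact le_self_add
    obtain ⟨⟨i, j⟩, hij⟩ : ∃ q : ι × ι, volume (γ q.1 '' ((({x | f x = some q.2}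
        ∩ γ q.2 ⁻¹' nbr γ B X) \ X) ∩ γ q.1 ⁻¹' Z)) ≠ 0 := by
      by_contra! h
      refine hZ0 (measure_mono_null ?_ (measure_union_null hcase (measure_iUnion_null h)))
      intro y hy
      by_cases hyN : y ∈ nbr γ B X
      · exact Or.inl ⟨hy, hyN⟩
      obtain ⟨hyB, i, x, hx, rfl⟩ := hZN hy
      have hxX : x ∉ X := fun hxX => hyN ⟨hyB, i, x, hxX, rfl⟩
      obtain ⟨j, hj, hxj⟩ := hx.resolve_left hxX
      exact Or.inr (mem_iUnion.2 ⟨(i, j), x, ⟨⟨⟨hj, hxj⟩, hxX⟩, hy⟩, rfl⟩)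
    dsimp only at hij
    set C := (({x | f x = some j} ∩ γ j ⁻¹' nbr γ B X) \ X) ∩ γ i ⁻¹' Z with hC
    have hCm : MeasurableSet C :=
      (((hf.measurable j).inter (hNm.preimage (γ j).continuous.measurable)).diff hXm).inter
        (hZ.preimage (γ i).continuous.measurable)
    have hCf : ∀ x ∈ C, f x = some j := fun x hx => hx.1.1.1
    have hCX : Disjoint C X := Set.disjoint_left.2 fun x hx => hx.1.2
    have hCA : C ⊆ A := fun x hx => (hf.mem (hCf x hx)).1
    have hCreach : C ⊆ altReach γ B f R (k + 1) := fun x hx => Or.inr ⟨j, hCf x hx, hx.1.1.2⟩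
    rw [volume_image] at hij
    set f₀ := reassign f C none with hf₀
    have hmi₀ : matchedImage γ f₀ = matchedImage γ f \ γ j '' C := hf.matchedImage_erase hCf
    obtain ⟨f₁, Z₁, h1, h2, h3, h4, h5, h6, h7⟩ := ih (hf.erase hCm) (fun x hx => by
        by_cases hxC : x ∈ C
        · exact reassign_of_mem hxC
        · rw [reassign_of_notMem hxC, hRf x hx]) (measurableSet_image (γ j) hCm) (by
        rintro _ ⟨x, hx, rfl⟩
        exact nbr_mono (subset_altReach_erase hCX) hx.1.1.2)
      (by rw [← hf₀, hmi₀]; exact disjoint_sdiff_right) (by rwa [volume_image])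
    rw [← hf₀] at h5 h6 h7
    have h5' : {x | f₁ x ≠ f₀ x} ⊆ X := h5.trans (altReach_erase_subset R C k)
    have hf₁C : ∀ x ∈ C, f₁ x = none := fun x hx => by
      by_contra h
      refine Set.disjoint_left.1 hCX hx (h5' ?_)
      rwa [mem_ofPred_eq, hf₀, reassign_of_mem hx]
    set C' := C ∩ γ j ⁻¹' Z₁ with hC'
    have hC'm : MeasurableSet C' := hCm.inter (h2.preimage (γ j).continuous.measurable)
    have hC'Z₁ : γ j '' C' = Z₁ := by
      refine subset_antisymm (by rintro _ ⟨x, hx, rfl⟩; exact hx.2) fun y hy => ?_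
      obtain ⟨x, hx, rfl⟩ := h3 hy
      exact ⟨x, ⟨hx, hy⟩, rfl⟩
    have hC'Z : γ i '' C' ⊆ Z := by rintro _ ⟨x, hx, rfl⟩; exact hx.1.2
    have hjC : γ j '' C ⊆ matchedImage γ f := by
      rintro _ ⟨x, hx, rfl⟩; exact ⟨x, j, hCf x hx, rfl⟩
    have hsd : γ j '' (C \ C') = γ j '' C \ Z₁ := by
      rw [image_sdiff (γ j).injective, hC'Z₁]
    have m2 : IsMatching γ A B (reassign f₁ (C \ C') (some j)) := by
      refine h1.assign (hCm.diff hC'm) (sdiff_subset.trans hCA)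
        (((image_mono sdiff_subset).trans hjC).trans hf.matchedImage_subset) ?_
      rw [hsd, h6, hmi₀]
      exact Set.disjoint_left.2 fun y hy h => h.elim (fun h => h.2 hy.1) hy.2
    have i2 : matchedImage γ (reassign f₁ (C \ C') (some j)) = matchedImage γ f := by
      rw [matchedImage_assign j fun x hx => hf₁C x hx.1, h6, hmi₀, hsd]
      ext y
      have := @hjC y
      have := @h3 y
      simp only [mem_union, Set.mem_sdiff]
      tauto
    set f₂ := reassign f₁ (C \ C') (some j) with hf₂
    have hf₂C' : ∀ x ∈ C', f₂ x = none := fun x hx => by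
      rw [hf₂, reassign_of_notMem fun h => h.2 hx, hf₁C x hx.1]
    have hdiff : {x | reassign f₂ C' (some i) x ≠ f x} ⊆ {x | f₁ x ≠ f₀ x} ∪ C' := by
      intro x hx
      by_contra! h
      rw [mem_union, not_or] at h
      apply hx
      rw [reassign_of_notMem h.2, hf₂]
      by_cases hxC : x ∈ C
      · rw [reassign_of_mem (show x ∈ C \ C' from ⟨hxC, h.2⟩), hCf x hxC]
      · rw [reassign_of_notMem fun h => hxC h.1, not_not.1 h.1, hf₀, reassign_of_notMem hxC]
    refine ⟨reassign f₂ C' (some i), γ i '' C', m2.assign hC'm (inter_subset_left.trans hCA)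
      (hC'Z.trans (hZN.trans nbr_subset)) ?_, measurableSet_image _ hC'm, hC'Z, ?_,
      hdiff.trans (union_subset (h5'.trans subset_union_left)
        (inter_subset_left.trans hCreach)), ?_, ?_⟩
    · rw [i2]
      exact hZf.mono_left hC'Z
    · rw [volume_image, ← volume_image (γ j), hC'Z₁]
      exact h4
    · rw [matchedImage_assign i hf₂C', i2]
    · refine (measure_mono hdiff).trans ((measure_union_le _ _).trans ?_)
      rw [volume_image]
      have : volume Z₁ = volume C' := by rw [← hC'Z₁, volume_image]
      rw [this] at h7
      push_cast
      rw [add_mul _ (1 : ENNReal), one_mul]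
      gcongr

end Matching

lemma expansion_recursion_bound {a ν : ℕ → ℝ} {m u : ℝ} (hm : 0 < m) (hu : 0 < u) {p : ℕ}
    (hp : m ≤ 2 ^ p * u) (h0 : u ≤ a 0) (h1 : ∀ k ≤ 2 * p, u + ν k ≤ a (k + 1))
    (h2 : ∀ k ≤ 2 * p, min (2 * a k) (2 / 3 * m) ≤ ν k)
    (h3 : ∀ k ≤ 2 * p, min (2 * (m - ν k)) (2 / 3 * m) ≤ m - a k) : m < a (2 * p + 1) := by
  have grow : ∀ k ≤ 2 * p, min (2 ^ k * u) (2 / 3 * m) ≤ a k := by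
    intro k hk
    induction k with
    | zero => exact (min_le_left _ _).trans (by simpa using h0)
    | succ k ih =>
      have ih := ih (by omega)
      have h1 := h1 k (by omega)
      have h2 := h2 k (by omega)
      rcases min_le_iff.1 ih with ih | ih <;> rcases min_le_iff.1 h2 with h2 | h2
      · exact (min_le_left _ _).trans (by rw [pow_succ]; linarith)
      all_goals exact (min_le_right _ _).trans (by linarith)
  have shrink : ∀ q ≤ p, m - a (p + q) ≤ m / 3 / 2 ^ q := by
    intro q hq
    induction q with
    | zero =>
      rcases min_le_iff.1 (grow p (by omega)) with h | h <;>
        simp only [add_zero, pow_zero, div_one] <;> linarith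
    | succ q ih =>
      have ih := ih (by omega)
      have hq1 : m / 3 / 2 ^ q ≤ m / 3 := div_le_self (by positivity) (one_le_pow₀ (by norm_num))
      have h1 := h1 (p + q) (by omega)
      rw [pow_succ, ← div_div, ← add_assoc]
      rcases min_le_iff.1 (h3 (p + q) (by omega)) with h | h <;> linarith
  have h := shrink p le_rfl
  rw [← two_mul] at h
  have hpu : m / 3 / 2 ^ p ≤ u / 3 := by
    rw [div_le_iff₀ (by positivity)]; linarith
  have hpm : m / 3 / 2 ^ p ≤ m / 3 := div_le_self (by positivity) (one_le_pow₀ (by norm_num))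
  have h1 := h1 (2 * p) le_rfl
  rcases min_le_iff.1 (h3 (2 * p) le_rfl) with h | h <;> linarith

lemma sq_two_mul_add_one_le (p : ℕ) : ((2 * p + 1 : ℝ)) ^ 2 ≤ 9 * 2 ^ p := by
  rcases p with _ | _ | p
  · norm_num
  · norm_num
  induction p with
  | zero => norm_num
  | succ p ih =>
    rw [pow_succ (2 : ℝ)]
    push_cast at ih ⊢
    nlinarith [sq_nonneg (p : ℝ), (Nat.cast_nonneg p : (0 : ℝ) ≤ p)]

section Matching

variable {n : ℕ} {ι : Type*} {γ : ι → EucSp n ≃ᵢ EucSp n} {A B : Set (EucSp n)}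
  {f g h : EucSp n → Option ι}

/-- The measure of the part of `A` left unmatched by `f`. -/
def defect (A : Set (EucSp n)) (f : EucSp n → Option ι) : ℝ :=
  volume.real (A ∩ {x | f x = none})

lemma IsMatching.ne_subset (hf : IsMatching γ A B f) (hg : IsMatching γ A B g) :
    {x | g x ≠ f x} ⊆ A := fun x hx => by
  rcases e : f x with _ | i
  · rcases e' : g x with _ | j
    · exact (hx (e'.trans e.symm)).elim
    · exact (hg.mem e').1
  · exact (hf.mem e).1

lemma IsMatching.defect_eq [Finite ι] (hf : IsMatching γ A B f) (hAB : volume A = volume B)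
    (hfin : volume A ≠ ⊤) : defect A f = volume.real (B \ matchedImage γ f) :=
  congrArg ENNReal.toReal (hf.volume_unmatched hAB hfin)

lemma IsMatching.measureReal_ne_triangle (hf : IsMatching γ A B f) (hg : IsMatching γ A B g)
    (hh : IsMatching γ A B h) (hfin : volume A ≠ ⊤) :
    volume.real {x | h x ≠ f x} ≤ volume.real {x | h x ≠ g x} + volume.real {x | g x ≠ f x} := by
  refine (measureReal_mono ?_ ?_).trans (measureReal_union_le _ _)
  · intro x hx
    by_contra hc
    rw [mem_union, not_or] at hc
    exact hx ((not_not.1 hc.1).trans (not_not.1 hc.2))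
  · exact ((measure_mono (union_subset (hg.ne_subset hh) (hf.ne_subset hg))).trans_lt
      hfin.lt_top).ne

lemma IsMatching.defect_le (hf : IsMatching γ A B f) (hg : IsMatching γ A B g)
    (hfin : volume A ≠ ⊤) : defect A f ≤ defect A g + volume.real {x | g x ≠ f x} := by
  refine (measureReal_mono ?_ ?_).trans (measureReal_union_le _ _)
  · rintro x ⟨hxA, hx⟩
    by_cases e : g x = none
    · exact Or.inl ⟨hxA, e⟩
    · exact Or.inr fun h => e (h.trans hx)
  · exact ((measure_mono (union_subset inter_subset_left (hf.ne_subset hg))).trans_lt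
      hfin.lt_top).ne

/-- Expansion in both directions makes unmatched points of `B` reachable from unmatched points
of `A` after logarithmically many alternations. -/
lemma IsMatching.volume_reachable_ne_zero [Finite ι] (hf : IsMatching γ A B f)
    (hA : MeasurableSet A) (hB : MeasurableSet B) (hAB : volume A = volume B)
    (hfin : volume A ≠ ⊤)
    (hexpA : ∀ U ⊆ A, MeasurableSet U →
      min (2 * volume.real U) (2 / 3 * volume.real B) ≤ volume.real (nbr γ B U))
    (hexpB : ∀ V ⊆ B, MeasurableSet V →
      min (2 * volume.real V) (2 / 3 * volume.real A) ≤
        volume.real {x | x ∈ A ∧ ∃ i, γ i x ∈ V})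
    (hu : 0 < defect A f) {p : ℕ} (hp : volume.real B ≤ 2 ^ p * defect A f) :
    volume (nbr γ B (altReach γ B f (A ∩ {x | f x = none}) (2 * p)) \ matchedImage γ f) ≠ 0 := by
  intro hzero
  set U := A ∩ {x | f x = none} with hU
  have hUm : MeasurableSet U := hA.inter hf.measurableSet_none
  have hXm := hf.measurableSet_altReach (R := U) hB hUm
  have hXA := hf.altReach_subset (R := U) inter_subset_left
  have hNm : ∀ k, MeasurableSet (nbr γ B (altReach γ B f U k)) := fun k =>
    measurableSet_nbr hB (hXm k)
  have hfinB : volume B ≠ ⊤ := hAB ▸ hfin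
  have hABr : volume.real A = volume.real B := congrArg ENNReal.toReal hAB
  have hXfin : ∀ k, volume (altReach γ B f U k) ≠ ⊤ := fun k =>
    ((measure_mono (hXA k)).trans_lt hfin.lt_top).ne
  have hm : 0 < volume.real B := by
    rw [← hABr]
    exact hu.trans_le (measureReal_mono inter_subset_left hfin)
  refine absurd (measureReal_mono (hXA (2 * p + 1)) hfin) (not_le.2 ?_)
  rw [hABr]
  refine expansion_recursion_bound (a := fun k => volume.real (altReach γ B f U k))
    (ν := fun k => volume.real (nbr γ B (altReach γ B f U k))) hm hu hp le_rfl ?_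
    (fun k _ => hexpA _ (hXA k) (hXm k)) ?_
  · intro k hk
    have hz : volume (nbr γ B (altReach γ B f U k) \ matchedImage γ f) = 0 :=
      measure_mono_null (sdiff_subset_sdiff_left (nbr_mono (altReach_mono U hk))) hzero
    have e : volume (nbr γ B (altReach γ B f U k))
        = volume {x | ∃ j, f x = some j ∧ γ j x ∈ nbr γ B (altReach γ B f U k)} := by
      rw [hf.volume_pullback (hNm k), ← measure_inter_add_sdiff _ hf.measurableSet_matchedImage,
        hz, add_zero, inter_comm]
    have hdisj : Disjoint U {x | ∃ j, f x = some j ∧ γ j x ∈ nbr γ B (altReach γ B f U k)} :=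
      Set.disjoint_left.2 fun x hx ⟨j, hj, _⟩ => by
        have := hx.2
        rw [mem_ofPred_eq, hj] at this
        exact Option.some_ne_none _ this
    have hsub : U ∪ {x | ∃ j, f x = some j ∧ γ j x ∈ nbr γ B (altReach γ B f U k)}
        ⊆ altReach γ B f U (k + 1) :=
      union_subset_union (altReach_mono U k.zero_le) subset_rfl
    have h1 := measureReal_mono hsub (hXfin (k + 1))
    rw [measureReal_union hdisj (hf.measurableSet_pullback (hNm k))
      ((measure_mono inter_subset_left).trans_lt hfin.lt_top).ne
      (by rw [← e]; exact ((measure_mono nbr_subset).trans_lt hfinB.lt_top).ne)] at h1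
    rw [show volume.real (nbr γ B (altReach γ B f U k)) = _ from congrArg ENNReal.toReal e]
    exact h1
  · intro k hk
    have h1 := hexpB (B \ nbr γ B (altReach γ B f U k)) sdiff_subset (hB.diff (hNm k))
    have h2 := measureReal_sdiff_add_inter (μ := volume) (s := B) (hNm k) hfinB
    rw [inter_eq_self_of_subset_right nbr_subset] at h2
    have h3 := measureReal_sdiff_add_inter (μ := volume) (s := A) (hXm k) hfin
    rw [inter_eq_self_of_subset_right (hXA k)] at h3
    have h4 : {x | x ∈ A ∧ ∃ i, γ i x ∈ B \ nbr γ B (altReach γ B f U k)}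
        ⊆ A \ altReach γ B f U k := by
      rintro x ⟨hx, i, hi⟩
      exact ⟨hx, fun h => hi.2 ⟨hi.1, i, x, h, rfl⟩⟩
    have h5 := measureReal_mono h4 ((measure_mono sdiff_subset).trans_lt hfin.lt_top).ne
    rw [hABr] at h1 h3
    rw [show volume.real B - volume.real (nbr γ B (altReach γ B f U k))
        = volume.real (B \ nbr γ B (altReach γ B f U k)) by linarith,
      show volume.real B - volume.real (altReach γ B f U k)
        = volume.real (A \ altReach γ B f U k) by linarith]
    exact h1.trans h5

/-- An imperfect matching can be improved at a cost controlled by the decrease of the square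
root of its defect. -/
lemma IsMatching.exists_improvement [Finite ι] (hf : IsMatching γ A B f)
    (hA : MeasurableSet A) (hB : MeasurableSet B) (hAB : volume A = volume B)
    (hfin : volume A ≠ ⊤)
    (hexpA : ∀ U ⊆ A, MeasurableSet U →
      min (2 * volume.real U) (2 / 3 * volume.real B) ≤ volume.real (nbr γ B U))
    (hexpB : ∀ V ⊆ B, MeasurableSet V →
      min (2 * volume.real V) (2 / 3 * volume.real A) ≤
        volume.real {x | x ∈ A ∧ ∃ i, γ i x ∈ V})
    (hu : 0 < defect A f) :
    ∃ g, IsMatching γ A B g ∧ defect A g < defect A f ∧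
      volume.real {x | g x ≠ f x} ≤ 12 * √(volume.real A) * (√(defect A f) - √(defect A g)) := by
  have hABr : volume.real A = volume.real B := congrArg ENNReal.toReal hAB
  have hum : defect A f ≤ volume.real A := measureReal_mono inter_subset_left hfin
  obtain ⟨q, hq1, hq2⟩ := exists_nat_pow_near ((one_le_div hu).2 hum) one_lt_two
  rw [le_div_iff₀ hu] at hq1
  rw [div_lt_iff₀ hu] at hq2
  set p := q + 1 with hp
  have hUm : MeasurableSet (A ∩ {x | f x = none}) := hA.inter hf.measurableSet_none
  have hne := hf.volume_reachable_ne_zero hA hB hAB hfin hexpA hexpB hu (hABr ▸ hq2.le)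
  obtain ⟨g, Z, hg, hZm, hZ, hZ0, -, hgi, hgd⟩ := IsMatching.exists_augmentation hB
    inter_subset_left hUm (2 * p) hf (fun x hx => hx.2)
    ((measurableSet_nbr hB (hf.measurableSet_altReach hB hUm _)).diff
      hf.measurableSet_matchedImage) sdiff_subset disjoint_sdiff_left hne
  have hfinB : volume B ≠ ⊤ := hAB ▸ hfin
  have hZB : Z ⊆ B \ matchedImage γ f := hZ.trans (sdiff_subset_sdiff_left nbr_subset)
  have hZfin : volume Z ≠ ⊤ :=
    ((measure_mono (hZB.trans sdiff_subset)).trans_lt hfinB.lt_top).ne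
  have hZpos : 0 < volume.real Z := ENNReal.toReal_pos hZ0 hZfin
  have hdef : defect A g + volume.real Z = defect A f := by
    rw [hf.defect_eq hAB hfin, hg.defect_eq hAB hfin, hgi, ← sdiff_sdiff,
      ← measureReal_sdiff_add_inter (s := B \ matchedImage γ f) hZm
        ((measure_mono sdiff_subset).trans_lt hfinB.lt_top).ne,
      inter_eq_self_of_subset_right hZB]
  have hg0 : 0 ≤ defect A g := measureReal_nonneg
  refine ⟨g, hg, by linarith, ?_⟩
  have h1 : volume.real {x | g x ≠ f x} ≤ (2 * p + 1) * volume.real Z := by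
    have := ENNReal.toReal_mono (ENNReal.mul_ne_top (by finiteness) hZfin) hgd
    rw [ENNReal.toReal_mul] at this
    rw [ENNReal.toReal_add (by finiteness) (by finiteness)] at this
    simpa [Measure.real] using this
  have hs := Real.sq_sqrt hu.le
  have hs' := Real.sq_sqrt hg0
  have hss : √(defect A g) ≤ √(defect A f) := Real.sqrt_le_sqrt (by linarith)
  have h2 : (2 * p + 1) * √(defect A f) ≤ 6 * √(volume.real A) := by
    refine abs_le_of_sq_le_sq' ?_ (by positivity) |>.2
    rw [mul_pow, mul_pow, hs, Real.sq_sqrt measureReal_nonneg]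
    have := sq_two_mul_add_one_le p
    calc (2 * (p : ℝ) + 1) ^ 2 * defect A f ≤ (9 * 2 ^ p) * defect A f := by gcongr
      _ = 18 * (2 ^ q * defect A f) := by rw [hp, pow_succ]; ring
      _ ≤ 6 ^ 2 * volume.real A := by linarith [measureReal_nonneg (μ := volume) (s := A)]
  calc _ ≤ (2 * p + 1) * volume.real Z := h1
    _ = (2 * p + 1) * (√(defect A f) + √(defect A g)) * (√(defect A f) - √(defect A g)) := by
      rw [eq_sub_iff_add_eq'.2 hdef, mul_assoc, ← sq_sub_sq, hs, hs']
    _ ≤ _ := by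
      refine mul_le_mul_of_nonneg_right ?_ (by linarith)
      have : (2 * (p : ℝ) + 1) * √(defect A g) ≤ (2 * p + 1) * √(defect A f) := by gcongr
      linarith

/-- Bilateral expansion yields a matching defined almost everywhere. -/
theorem exists_matching_of_expansion [Finite ι]
    (hA : MeasurableSet A) (hB : MeasurableSet B) (hAB : volume A = volume B)
    (hfin : volume A ≠ ⊤)
    (hexpA : ∀ U ⊆ A, MeasurableSet U →
      min (2 * volume.real U) (2 / 3 * volume.real B) ≤ volume.real (nbr γ B U))
    (hexpB : ∀ V ⊆ B, MeasurableSet V →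
      min (2 * volume.real V) (2 / 3 * volume.real A) ≤
        volume.real {x | x ∈ A ∧ ∃ i, γ i x ∈ V}) :
    ∃ f, IsMatching γ A B f ∧ volume (A ∩ {x | f x = none}) = 0 ∧
      volume (B \ matchedImage γ f) = 0 := by
  set K : ℝ := 12 * √(volume.real A) with hK
  have hK0 : 0 ≤ K := by positivity
  set D : (EucSp n → Option ι) → (EucSp n → Option ι) → Prop := fun g f =>
    volume.real {x | g x ≠ f x} ≤ K * √(defect A f) - K * √(defect A g) with hD
  have hdef0 : ∀ f : EucSp n → Option ι, 0 ≤ defect A f := fun f => measureReal_nonneg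
  have htrans : ∀ {f g h : EucSp n → Option ι}, IsMatching γ A B f → IsMatching γ A B g →
      IsMatching γ A B h → D h g → D g f → D h f := fun hf hg hh h1 h2 => by
    have h3 := hf.measureReal_ne_triangle hg hh hfin
    simp only [hD] at h1 h2 ⊢
    linarith
  have hselect : ∀ f, IsMatching γ A B f → ∃ g, IsMatching γ A B g ∧ D g f ∧
      ∀ h, IsMatching γ A B h → D h f → defect A g ≤ (defect A f + defect A h) / 2 := by
    intro f hf
    set S := {r | ∃ g, IsMatching γ A B g ∧ D g f ∧ defect A g = r} with hS
    have hbdd : BddBelow S := ⟨0, by rintro _ ⟨g, -, -, rfl⟩; exact hdef0 g⟩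
    have hfS : defect A f ∈ S := ⟨f, hf, by simp [hD], rfl⟩
    rcases (csInf_le hbdd hfS).eq_or_lt with h | h
    · refine ⟨f, hf, by simp [hD], fun g hg hgf => ?_⟩
      have := csInf_le hbdd (show defect A g ∈ S from ⟨g, hg, hgf, rfl⟩)
      linarith
    · obtain ⟨_, ⟨g, hg, hgf, rfl⟩, hlt⟩ :=
        exists_lt_of_csInf_lt ⟨_, hfS⟩ (show sInf S < (defect A f + sInf S) / 2 by linarith)
      refine ⟨g, hg, hgf, fun h hh hhf => ?_⟩
      have := csInf_le hbdd (show defect A h ∈ S from ⟨h, hh, hhf, rfl⟩)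
      linarith
  have hzero : IsMatching γ A B (fun _ => (none : Option ι)) :=
    ⟨fun i => by simp, fun h => by simp at h, fun h => by simp at h⟩
  choose! next hnext hnextD hnextmin using hselect
  set F : ℕ → EucSp n → Option ι := fun k => next^[k] fun _ => none with hF
  have hFsucc : ∀ k, F (k + 1) = next (F k) := fun k => Function.iterate_succ_apply' _ _ _
  have hFm : ∀ k, IsMatching γ A B (F k) := fun k => by
    induction k with
    | zero => exact hzero
    | succ k ih => rw [hFsucc]; exact hnext _ ih
  have hFD : ∀ k, D (F (k + 1)) (F k) := fun k => by rw [hFsucc]; exact hnextD _ (hFm k)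
  have hanti : Antitone fun k => K * √(defect A (F k)) := antitone_nat_of_succ_le fun k => by
    have h1 : 0 ≤ volume.real {x | F (k + 1) x ≠ F k x} := measureReal_nonneg
    have h2 := hFD k
    simp only [hD] at h2
    linarith
  obtain ⟨L, hL⟩ : ∃ L, Filter.Tendsto (fun k => K * √(defect A (F k))) Filter.atTop (nhds L) :=
    ⟨_, tendsto_atTop_ciInf hanti ⟨0, by rintro _ ⟨k, rfl⟩; positivity⟩⟩
  have hLle : ∀ k, L ≤ K * √(defect A (F k)) := fun k => hanti.le_of_tendsto hL k
  classical
  set f : EucSp n → Option ι := fun x =>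
    if h : ∃ i, ∀ᶠ k in Filter.atTop, F k x = some i then some h.choose else none with hfdef
  have hfsome : ∀ {x i}, f x = some i ↔ ∀ᶠ k in Filter.atTop, F k x = some i := by
    intro x i
    constructor
    · intro h
      by_cases hc : ∃ i, ∀ᶠ k in Filter.atTop, F k x = some i
      · rw [hfdef] at h
        simp only [dif_pos hc, Option.some_inj] at h
        exact h ▸ hc.choose_spec
      · rw [hfdef] at h
        simp only [dif_neg hc] at h
        exact (Option.some_ne_none _ h.symm).elim
    · intro h
      have hc : ∃ i, ∀ᶠ k in Filter.atTop, F k x = some i := ⟨i, h⟩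
      obtain ⟨k, h1, h2⟩ := (h.and hc.choose_spec).exists
      simp only [hfdef, dif_pos hc]
      rw [← h2, h1]
  have hf : IsMatching γ A B f := by
    refine ⟨fun i => ?_, fun {x i} h => ?_, fun {x y i j} hx hy e => ?_⟩
    · have : {x | f x = some i} = ⋃ k, ⋂ l, ⋂ (_ : k ≤ l), {x | F l x = some i} := by
        ext x
        simp only [mem_ofPred_eq, hfsome, Filter.eventually_atTop, mem_iUnion, mem_iInter]
      rw [this]
      exact MeasurableSet.iUnion fun k => MeasurableSet.iInter fun l =>
        MeasurableSet.iInter fun _ => (hFm l).measurable i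
    · obtain ⟨k, hk⟩ := (hfsome.1 h).exists
      exact (hFm k).mem hk
    · obtain ⟨k, hkx, hky⟩ := ((hfsome.1 hx).and (hfsome.1 hy)).exists
      exact (hFm k).inj hkx hky e
  have hlim : ∀ k, volume.real {x | f x ≠ F k x} ≤ K * √(defect A (F k)) - L := by
    intro k
    have hsub : {x | f x ≠ F k x} ⊆ ⋃ l, {x | F (k + (l + 1)) x ≠ F (k + l) x} := by
      intro x hx
      by_contra hc
      simp only [mem_iUnion, mem_ofPred_eq, not_exists, not_not] at hc
      have hconst : ∀ l, F (k + l) x = F k x := fun l => by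
        induction l with
        | zero => rfl
        | succ l ih => rw [hc l, ih]
      apply hx
      rcases e : F k x with _ | i
      · rw [Option.eq_none_iff_forall_ne_some]
        intro i hi
        obtain ⟨k', h1, h2⟩ := ((hfsome.1 hi).and (Filter.eventually_ge_atTop k)).exists
        obtain ⟨l, rfl⟩ := Nat.exists_eq_add_of_le h2
        rw [hconst l, e] at h1
        exact Option.some_ne_none _ h1.symm
      · refine hfsome.2 (Filter.eventually_atTop.2 ⟨k, fun k' hk' => ?_⟩)
        obtain ⟨l, rfl⟩ := Nat.exists_eq_add_of_le hk'
        rw [hconst l, e]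
    have hpart : ∀ N, ∑ l ∈ Finset.range N, volume.real {x | F (k + (l + 1)) x ≠ F (k + l) x}
        ≤ K * √(defect A (F k)) - K * √(defect A (F (k + N))) := fun N => by
      induction N with
      | zero => simp
      | succ N ih =>
        rw [Finset.sum_range_succ]
        have := hFD (k + N)
        simp only [hD] at this
        rw [add_assoc] at this
        linarith
    have hfinl : ∀ l, volume {x | F (k + (l + 1)) x ≠ F (k + l) x} ≠ ⊤ := fun l =>
      ((measure_mono ((hFm _).ne_subset (hFm _))).trans_lt hfin.lt_top).ne
    refine ENNReal.toReal_le_of_le_ofReal (by linarith [hLle k]) ?_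
    refine (measure_mono hsub).trans ((measure_iUnion_le _).trans ?_)
    refine ENNReal.tsum_le_of_sum_range_le fun N => ?_
    rw [← ENNReal.ofReal_toReal (ENNReal.sum_ne_top.2 fun l _ => hfinl l),
      ENNReal.toReal_sum fun l _ => hfinl l]
    refine ENNReal.ofReal_le_ofReal ((hpart N).trans ?_)
    linarith [hLle (k + N)]
  have hdef : Filter.Tendsto (fun k => defect A (F k)) Filter.atTop (nhds (defect A f)) := by
    rw [tendsto_iff_dist_tendsto_zero]
    refine squeeze_zero (fun _ => dist_nonneg) (fun k => ?_) (by simpa using hL.sub_const L)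
    rw [Real.dist_eq, abs_le]
    have h1 := (hFm k).defect_le hf hfin
    have h2 := hf.defect_le (hFm k) hfin
    simp only [ne_comm (a := F k _)] at h2
    constructor <;> linarith [hlim k]
  have hLeq : L = K * √(defect A f) := tendsto_nhds_unique hL (hdef.sqrt.const_mul K)
  have hperf : defect A f = 0 := by
    by_contra hne
    obtain ⟨g, hg, hlt, hgd⟩ := hf.exists_improvement hA hB hAB hfin hexpA hexpB
      (lt_of_le_of_ne (hdef0 f) (Ne.symm hne))
    have hgf : D g f := by simpa only [hD, mul_sub] using hgd
    have h1 : ∀ k, defect A (F (k + 1)) ≤ (defect A (F k) + defect A g) / 2 := fun k => by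
      rw [hFsucc]
      refine hnextmin _ (hFm k) g hg (htrans (hFm k) hf hg hgf ?_)
      have := hlim k
      rwa [hLeq] at this
    have h2 := le_of_tendsto_of_tendsto' (hdef.comp (Filter.tendsto_add_atTop_nat 1))
      ((hdef.add_const (defect A g)).div_const 2) h1
    linarith
  have hz : volume (A ∩ {x | f x = none}) = 0 :=
    (measureReal_eq_zero_iff ((measure_mono inter_subset_left).trans_lt hfin.lt_top).ne).1 hperf
  exact ⟨f, hf, hz, (hf.volume_unmatched hAB hfin).symm.trans hz⟩

end Matching

open Classical in
/-- Products of boundedly many planar rotations expand finite sets of nonzero vectors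
exponentially. -/
lemma exists_rotations_expanding {n : ℕ} (hn : 3 ≤ n) (k : ℕ) :
    ∃ S : Finset (EucSp n ≃ₗᵢ[ℝ] EucSp n), ∀ U : Finset (EucSp n), 0 ∉ U →
      (Fintype.card (CoordPair n) + 1) ^ k * U.card
        ≤ Fintype.card (CoordPair n) ^ k * (S.biUnion fun g => U.image g).card := by
  induction k with
  | zero =>
    refine ⟨{LinearIsometryEquiv.refl ℝ _}, fun U _ => ?_⟩
    simp
  | succ k ih =>
    obtain ⟨S, hS⟩ := ih
    refine ⟨S ∪ Finset.univ.biUnion fun p : CoordPair n => S.image fun g => g.trans (planeRot p),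
      fun U hU => ?_⟩
    set N := Fintype.card (CoordPair n)
    set W := S.biUnion fun g => U.image g with hW
    set W' := (S ∪ Finset.univ.biUnion fun p : CoordPair n =>
      S.image fun g => g.trans (planeRot p)).biUnion fun g => U.image g with hW'
    have hW0 : 0 ∉ W := by
      simp only [hW, Finset.mem_biUnion, Finset.mem_image, not_exists, not_and]
      intro g _ x hx h
      rw [map_eq_zero_iff g g.injective] at h
      exact hU (h ▸ hx)
    have hsub : ∀ p, W ∪ W.image (planeRot p) \ W ⊆ W' := by
      intro p
      rw [Finset.union_sdiff_self_eq_union]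
      refine Finset.union_subset ?_ ?_
      · exact Finset.biUnion_subset_biUnion_of_subset_left _ Finset.subset_union_left
      · intro y hy
        obtain ⟨_, hx, rfl⟩ := Finset.mem_image.1 hy
        obtain ⟨g, hg, hx⟩ := Finset.mem_biUnion.1 hx
        obtain ⟨u, hu, rfl⟩ := Finset.mem_image.1 hx
        refine Finset.mem_biUnion.2 ⟨g.trans (planeRot p), Finset.mem_union_right _
          (Finset.mem_biUnion.2 ⟨p, Finset.mem_univ _, Finset.mem_image_of_mem _ hg⟩),
          Finset.mem_image.2 ⟨u, hu, rfl⟩⟩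
    have hcard : (N + 1) * W.card ≤ N * W'.card := by
      calc (N + 1) * W.card = N * W.card + W.card := by ring
        _ ≤ N * W.card + ∑ p : CoordPair n, (W.image (planeRot p) \ W).card :=
          Nat.add_le_add_left (card_le_sum_card_image_planeRot_sdiff hn W hW0) _
        _ = ∑ p : CoordPair n, (W ∪ W.image (planeRot p) \ W).card := by
          simp_rw [Finset.card_union_of_disjoint Finset.disjoint_sdiff, Finset.sum_add_distrib,
            Finset.sum_const, smul_eq_mul, Finset.card_univ]
          rfl
        _ ≤ ∑ _p : CoordPair n, W'.card := Finset.sum_le_sum fun p _ =>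
          Finset.card_le_card (hsub p)
        _ = N * W'.card := by simp [N]
    calc (N + 1) ^ (k + 1) * U.card = (N + 1) * ((N + 1) ^ k * U.card) := by ring
      _ ≤ (N + 1) * (N ^ k * W.card) := Nat.mul_le_mul_left _ (hS U hU)
      _ = N ^ k * ((N + 1) * W.card) := by ring
      _ ≤ N ^ k * (N * W'.card) := Nat.mul_le_mul_left _ hcard
      _ = N ^ (k + 1) * W'.card := by ring

open Classical in
lemma exists_rotations_multiplying {n : ℕ} (hn : 3 ≤ n) (M : ℕ) :
    ∃ S : Finset (EucSp n ≃ₗᵢ[ℝ] EucSp n), ∀ U : Finset (EucSp n), 0 ∉ U →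
      M * U.card ≤ (S.biUnion fun g => U.image g).card := by
  have hN : 0 < Fintype.card (CoordPair n) :=
    Fintype.card_pos_iff.2 ⟨⟨(⟨0, by omega⟩, ⟨1, by omega⟩), by simp [Fin.ext_iff]⟩⟩
  set N := Fintype.card (CoordPair n) with hNdef
  have hN' : (0 : ℝ) < N := by exact_mod_cast hN
  obtain ⟨k, hk⟩ := pow_unbounded_of_one_lt (M : ℝ) (y := ((N : ℝ) + 1) / N)
    (by rw [one_lt_div hN']; linarith)
  rw [div_pow, lt_div_iff₀ (by positivity)] at hk
  have hk' : M * N ^ k ≤ (N + 1) ^ k := by exact_mod_cast hk.le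
  obtain ⟨S, hS⟩ := exists_rotations_expanding hn k
  refine ⟨S, fun U hU => Nat.le_of_mul_le_mul_left ?_ (pow_pos hN k)⟩
  calc N ^ k * (M * U.card) = M * N ^ k * U.card := by ring
    _ ≤ (N + 1) ^ k * U.card := Nat.mul_le_mul_right _ hk'
    _ ≤ _ := hS U hU

/-- A finite set of centers such that each point of a bounded set is close to, but different
from, one of them. -/
lemma exists_finite_centers {n : ℕ} (hn : 3 ≤ n) {A : Set (EucSp n)} (hA : Bornology.IsBounded A)
    {r : ℝ} (hr : 0 < r) :
    ∃ X : Finset (EucSp n), ∀ a ∈ A, ∃ x ∈ X, a - x ≠ 0 ∧ ‖a - x‖ ≤ r := by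
  classical
  obtain ⟨X, hXf, hX⟩ := Metric.totallyBounded_iff.1
    (hA.isCompact_closure.totallyBounded.subset subset_closure) r hr
  have : Nonempty (Fin n) := ⟨⟨0, by omega⟩⟩
  obtain ⟨v, hv⟩ := exists_norm_eq (EucSp n) hr.le
  refine ⟨hXf.toFinset ∪ hXf.toFinset.image (· + v), fun a ha => ?_⟩
  obtain ⟨x, hx, hax⟩ := mem_iUnion₂.1 (hX ha)
  rw [Metric.mem_ball, dist_eq_norm] at hax
  have hx' : x ∈ hXf.toFinset := hXf.mem_toFinset.2 hx
  by_cases h : a = x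
  · refine ⟨x + v, Finset.mem_union_right _ (Finset.mem_image_of_mem _ hx'), ?_, ?_⟩
    · rw [h, sub_add_cancel_left, neg_ne_zero]
      rintro rfl
      rw [norm_zero] at hv
      exact hr.ne hv
    · rw [h, sub_add_cancel_left, norm_neg, hv]
  · exact ⟨x, Finset.mem_union_left _ hx', sub_ne_zero.2 h, hax.le⟩

/-- Finitely many isometries satisfy Hall's condition between a bounded set and a set with
nonempty interior. -/
lemma exists_hall_isometries {n : ℕ} (hn : 3 ≤ n) {A B : Set (EucSp n)}
    (hA : Bornology.IsBounded A) (hB : (interior B).Nonempty) :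
    ∃ T : Finset (EucSp n ≃ᵢ EucSp n), ∀ U : Finset (EucSp n), ↑U ⊆ A →
      ∃ W : Finset (EucSp n), U.card ≤ W.card ∧
        ∀ w ∈ W, w ∈ B ∧ ∃ g ∈ T, ∃ u ∈ U, g u = w := by
  classical
  obtain ⟨y, hy⟩ := hB
  obtain ⟨r, hr, hrB⟩ := Metric.nhds_basis_closedBall.mem_iff.1 (mem_interior_iff_mem_nhds.1 hy)
  obtain ⟨X, hX⟩ := exists_finite_centers hn hA hr
  obtain ⟨S, hS⟩ := exists_rotations_multiplying hn X.card
  set move : EucSp n → (EucSp n ≃ₗᵢ[ℝ] EucSp n) → EucSp n ≃ᵢ EucSp n := fun x g =>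
    ((IsometryEquiv.subRight x).trans g.toIsometryEquiv).trans (IsometryEquiv.addRight y)
    with hmove
  have hmove' : ∀ x g u, move x g u = g (u - x) + y := fun x g u => rfl
  refine ⟨X.biUnion fun x => S.image (move x), fun U hU => ?_⟩
  rcases U.eq_empty_or_nonempty with rfl | hUne
  · exact ⟨∅, le_rfl, by simp⟩
  have hXne : X.Nonempty := by
    obtain ⟨u, hu⟩ := hUne
    obtain ⟨x, hx, -⟩ := hX u (hU hu)
    exact ⟨x, hx⟩
  set near : EucSp n → Finset (EucSp n) := fun x =>
    U.filter fun u => u - x ≠ 0 ∧ ‖u - x‖ ≤ r with hnear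
  have hcov : U ⊆ X.biUnion near := fun u hu => by
    obtain ⟨x, hx, h⟩ := hX u (hU hu)
    exact Finset.mem_biUnion.2 ⟨x, hx, Finset.mem_filter.2 ⟨hu, h⟩⟩
  obtain ⟨x, hx, hmax⟩ := X.exists_max_image (fun x => (near x).card) hXne
  have hle : U.card ≤ X.card * (near x).card :=
    (Finset.card_le_card hcov).trans
      (Finset.card_biUnion_le.trans (Finset.sum_le_card_nsmul _ _ _ hmax))
  set V := (near x).image (· - x) with hV
  have hVcard : V.card = (near x).card := Finset.card_image_of_injective _ sub_left_injective
  have hVmem : ∀ v ∈ V, ∃ u ∈ U, v ≠ 0 ∧ ‖v‖ ≤ r ∧ u - x = v := fun v hv => by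
    obtain ⟨u, hu, rfl⟩ := Finset.mem_image.1 hv
    obtain ⟨h1, h2, h3⟩ := Finset.mem_filter.1 hu
    exact ⟨u, h1, h2, h3, rfl⟩
  have hV0 : 0 ∉ V := fun h => by
    obtain ⟨u, -, h, -⟩ := hVmem 0 h
    exact h rfl
  refine ⟨(S.biUnion fun g => V.image g).image (· + y), ?_, ?_⟩
  · rw [Finset.card_image_of_injective _ (add_left_injective y)]
    exact hle.trans (hVcard ▸ hS V hV0)
  · intro w hw
    obtain ⟨_, hw', rfl⟩ := Finset.mem_image.1 hw
    obtain ⟨g, hg, hw'⟩ := Finset.mem_biUnion.1 hw'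
    obtain ⟨v, hv, rfl⟩ := Finset.mem_image.1 hw'
    obtain ⟨u, hu, -, hvr, huv⟩ := hVmem v hv
    refine ⟨hrB ?_, move x g, Finset.mem_biUnion.2 ⟨x, hx, Finset.mem_image_of_mem _ hg⟩, u, hu,
      by rw [hmove', huv]⟩
    rw [Metric.mem_closedBall, dist_eq_norm, add_sub_cancel_right, g.norm_map]
    exact hvr

/-- Hall's theorem inside an invariant set. -/
lemma exists_injection_of_hall {n : ℕ} {A B N : Set (EucSp n)}
    {T : Finset (EucSp n ≃ᵢ EucSp n)}
    (hT : ∀ U : Finset (EucSp n), ↑U ⊆ A → ∃ W : Finset (EucSp n), U.card ≤ W.card ∧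
        ∀ w ∈ W, w ∈ B ∧ ∃ g ∈ T, ∃ u ∈ U, g u = w)
    (hN : ∀ g ∈ T, ∀ x ∈ N, g x ∈ N) :
    ∃ φ : ↥(A ∩ N) → ↥(B ∩ N), Function.Injective φ ∧ ∀ x : ↥(A ∩ N), ∃ g ∈ T, g x = φ x := by
  classical
  set t : ↥(A ∩ N) → Finset (EucSp n) := fun x =>
    (T.image fun g => g x).filter (· ∈ B) with ht
  obtain ⟨φ, hφ, hφt⟩ := (Finset.all_card_le_biUnion_card_iff_exists_injective t).1 fun s => by
    obtain ⟨W, hW, hW'⟩ := hT (s.image Subtype.val) (by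
      intro u hu
      obtain ⟨x, -, rfl⟩ := Finset.mem_image.1 (Finset.mem_coe.1 hu)
      exact x.2.1)
    rw [Finset.card_image_of_injective _ Subtype.val_injective] at hW
    refine hW.trans (Finset.card_le_card fun w hw => ?_)
    obtain ⟨hwB, g, hg, u, hu, rfl⟩ := hW' w hw
    obtain ⟨x, hx, rfl⟩ := Finset.mem_image.1 hu
    exact Finset.mem_biUnion.2 ⟨x, hx, Finset.mem_filter.2 ⟨Finset.mem_image_of_mem _ hg, hwB⟩⟩
  have key : ∀ x : ↥(A ∩ N), φ x ∈ B ∧ ∃ g ∈ T, g x = φ x := fun x => by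
    obtain ⟨h1, h2⟩ := Finset.mem_filter.1 (hφt x)
    exact ⟨h2, Finset.mem_image.1 h1⟩
  refine ⟨fun x => ⟨φ x, (key x).1, ?_⟩, fun x y h => hφ (congrArg Subtype.val h),
    fun x => (key x).2⟩
  obtain ⟨g, hg, e⟩ := (key x).2
  exact e ▸ hN g hg x x.2.2

/-- Inside invariant sets, bounded sets with nonempty interior are equidecomposable by a fixed
finite set of isometries. -/
theorem exists_bijection_on_invariant {n : ℕ} (hn : 3 ≤ n) {A B : Set (EucSp n)}
    (hA : Bornology.IsBounded A) (hB : Bornology.IsBounded B) (hAi : (interior A).Nonempty)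
    (hBi : (interior B).Nonempty) :
    ∃ T : Finset (EucSp n ≃ᵢ EucSp n), ∀ N : Set (EucSp n),
      (∀ g ∈ T, ∀ x, g x ∈ N ↔ x ∈ N) →
      ∃ φ : ↥(A ∩ N) → ↥(B ∩ N), Function.Bijective φ ∧
        ∀ x : ↥(A ∩ N), ∃ g ∈ T, g x = φ x := by
  classical
  obtain ⟨T₁, h₁⟩ := exists_hall_isometries hn hA hBi
  obtain ⟨T₂, h₂⟩ := exists_hall_isometries hn hB hAi
  refine ⟨T₁ ∪ T₂.image (·⁻¹), fun N hN => ?_⟩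
  obtain ⟨φ, hφ, hφ'⟩ := exists_injection_of_hall (N := N) h₁ fun g hg x hx =>
    (hN g (Finset.mem_union_left _ hg) x).2 hx
  obtain ⟨ψ, hψ, hψ'⟩ := exists_injection_of_hall (N := N) h₂ fun g hg x hx => by
    rw [← hN g⁻¹ (Finset.mem_union_right _ (Finset.mem_image_of_mem _ hg)) (g x)]
    rwa [← IsometryEquiv.mul_apply, inv_mul_cancel]
  refine Function.Embedding.schroeder_bernstein_of_rel hφ hψ
    (fun x y => ∃ g ∈ T₁ ∪ T₂.image (·⁻¹), g x = (y : EucSp n)) (fun x => ?_) fun y => ?_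
  · obtain ⟨g, hg, e⟩ := hφ' x
    exact ⟨g, Finset.mem_union_left _ hg, e⟩
  · obtain ⟨g, hg, e⟩ := hψ' y
    refine ⟨g⁻¹, Finset.mem_union_right _ (Finset.mem_image_of_mem _ hg), ?_⟩
    rw [← e, ← IsometryEquiv.mul_apply, inv_mul_cancel]
    rfl

lemma exists_null_invariant {n : ℕ} {T : Set (EucSp n ≃ᵢ EucSp n)} (hT : T.Finite)
    {Z : Set (EucSp n)} (hZ : volume Z = 0) :
    ∃ N, Z ⊆ N ∧ volume N = 0 ∧ ∀ g ∈ T, ∀ x, g x ∈ N ↔ x ∈ N := by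
  set S : Set (EucSp n ≃ᵢ EucSp n) := insert 1 (T ∪ T⁻¹) with hS
  have hSf : S.Finite := (hT.union hT.inv).insert 1
  have hstep : ∀ g ∈ S, ∀ x ∈ ⋃ k, spread (S ^ k) Z, g x ∈ ⋃ k, spread (S ^ k) Z := by
    intro g hg x hx
    obtain ⟨k, hk⟩ := mem_iUnion.1 hx
    exact mem_iUnion.2 ⟨k + 1, by rw [spread_pow_succ]; exact mem_spread.2 ⟨g, hg, x, hk, rfl⟩⟩
  refine ⟨⋃ k, spread (S ^ k) Z, fun x hx => mem_iUnion.2 ⟨0, ?_⟩, ?_, fun g hg x => ⟨fun h => ?_,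
    hstep g (Or.inr (Or.inl hg)) x⟩⟩
  · rwa [pow_zero, spread_one]
  · refine measure_iUnion_null fun k => (measure_biUnion_null_iff
      (finite_pow hSf k).countable).2 fun g _ => ?_
    rw [volume_image, hZ]
  · have := hstep g⁻¹ (Or.inr (Or.inr (Set.inv_mem_inv.2 hg))) _ h
    rwa [← IsometryEquiv.mul_apply, inv_mul_cancel] at this

lemma measurablyEquidecomposable_of_bijOn {n : ℕ} {ι : Type*} [Finite ι]
    {γ : ι → EucSp n ≃ᵢ EucSp n} {A B : Set (EucSp n)} {s : EucSp n → ι}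
    (hs : BijOn (fun x => γ (s x) x) A B)
    (hm : ∀ i, NullMeasurableSet {x | x ∈ A ∧ s x = i} volume) :
    MeasurablyEquidecomposable n A B := by
  obtain ⟨m, ⟨e⟩⟩ := Finite.exists_equiv_fin ι
  refine ⟨m, fun i => γ (e.symm i), fun i => {x | x ∈ A ∧ s x = e.symm i}, fun i => hm _,
    fun i j hij => ?_, ?_, fun i j hij => ?_, ?_⟩
  · refine Set.disjoint_left.2 fun x hx hy => hij (e.symm.injective (hx.2.symm.trans hy.2))
  · ext x
    simp only [mem_iUnion, mem_ofPred_eq]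
    exact ⟨fun ⟨_, h, _⟩ => h, fun h => ⟨e (s x), h, (e.symm_apply_apply _).symm⟩⟩
  · refine Set.disjoint_left.2 ?_
    rintro _ ⟨x, ⟨hx, hxi⟩, rfl⟩ ⟨y, ⟨hy, hyj⟩, hxy⟩
    change γ (e.symm j) y = γ (e.symm i) x at hxy
    rw [← hxi, ← hyj] at hxy
    have := hs.injOn hy hx hxy
    subst this
    exact hij (e.symm.injective (hxi.symm.trans hyj))
  · ext y
    simp only [mem_iUnion, mem_image]
    constructor
    · rintro ⟨i, x, ⟨hx, hxi⟩, rfl⟩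
      rw [← hxi]
      exact hs.mapsTo hx
    · intro hy
      obtain ⟨x, hx, rfl⟩ := hs.surjOn hy
      exact ⟨e (s x), x, ⟨hx, (e.symm_apply_apply _).symm⟩, by rw [e.symm_apply_apply]⟩

/-- Bounded measurable sets with nonempty interiors and equal volumes are measurably
equidecomposable in dimension at least three. -/
theorem measurablyEquidecomposable_of_volume_eq {n : ℕ} (hn : 3 ≤ n) {A B : Set (EucSp n)}
    (hA : Bornology.IsBounded A) (hB : Bornology.IsBounded B) (hAm : MeasurableSet A)
    (hBm : MeasurableSet B) (hAi : (interior A).Nonempty) (hBi : (interior B).Nonempty)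
    (hAB : volume A = volume B) : MeasurablyEquidecomposable n A B := by
  obtain ⟨T₁, hT₁, hexp₁⟩ := exists_expansion hn hA hB hBm hBi
  obtain ⟨T₂, hT₂, hexp₂⟩ := exists_expansion hn hB hA hAm hAi
  obtain ⟨T₃, hhall⟩ := exists_bijection_on_invariant hn hA hB hAi hBi
  have hfin : volume A ≠ ⊤ := hA.measure_lt_top.ne
  have hfinB : volume B ≠ ⊤ := hB.measure_lt_top.ne
  set T : Set (EucSp n ≃ᵢ EucSp n) := T₁ ∪ T₂⁻¹ ∪ T₃ with hT
  have hTf : T.Finite := (hT₁.union hT₂.inv).union T₃.finite_toSet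
  have : Finite T := hTf
  set γ : T → EucSp n ≃ᵢ EucSp n := Subtype.val with hγ
  obtain ⟨f, hf, hf₁, hf₂⟩ := exists_matching_of_expansion (γ := γ) hAm hBm hAB hfin
    (fun U hU hUm => (hexp₁ U hU hUm).trans (measureReal_mono (by
        rintro y ⟨hy, hyB⟩
        obtain ⟨g, hg, x, hx, rfl⟩ := mem_spread.1 hy
        exact ⟨hyB, ⟨g, Or.inl (Or.inl hg)⟩, x, hx, rfl⟩)
      ((measure_mono nbr_subset).trans_lt hfinB.lt_top).ne))
    (fun V hV hVm => (hexp₂ V hV hVm).trans (measureReal_mono (by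
        rintro x ⟨hx, hxA⟩
        obtain ⟨g, hg, y, hy, rfl⟩ := mem_spread.1 hx
        refine ⟨hxA, ⟨g⁻¹, Or.inl (Or.inr (Set.inv_mem_inv.2 hg))⟩, ?_⟩
        change g⁻¹ (g y) ∈ V
        rwa [← IsometryEquiv.mul_apply, inv_mul_cancel])
      ((measure_mono fun x hx => hx.1).trans_lt hfin.lt_top).ne))
  obtain ⟨N, hZN, hN0, hNinv⟩ := exists_null_invariant hTf (measure_union_null hf₁ hf₂)
  obtain ⟨φ, hφ, hφT⟩ := hhall N fun g hg => hNinv g (Or.inr hg)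
  have hsel : ∀ x ∈ A, ∃ i : T, (x ∉ N → f x = some i) ∧
      ∀ h : x ∈ A ∩ N, γ i x = φ ⟨x, h⟩ := by
    intro x hx
    by_cases hxN : x ∈ N
    · obtain ⟨g, hg, e⟩ := hφT ⟨x, hx, hxN⟩
      exact ⟨⟨g, Or.inr hg⟩, fun h => (h hxN).elim, fun _ => e⟩
    · obtain ⟨i, hi⟩ := Option.ne_none_iff_exists'.1 fun h => hxN (hZN (Or.inl ⟨hx, h⟩))
      exact ⟨i, fun _ => hi, fun h => (hxN h.2).elim⟩
  obtain ⟨a, ha⟩ := hAi.mono interior_subset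
  have : Nonempty T := ⟨(hsel a ha).choose⟩
  choose! s hs₁ hs₂ using hsel
  have hsN : ∀ x, γ (s x) x ∈ N ↔ x ∈ N := fun x => hNinv _ (s x).2 x
  refine measurablyEquidecomposable_of_bijOn (γ := γ) (s := s) ⟨?_, ?_, ?_⟩ fun i => ?_
  · intro x hx
    by_cases hxN : x ∈ N
    · change γ (s x) x ∈ B
      rw [hs₂ x hx ⟨hx, hxN⟩]
      exact (φ _).2.1
    · exact (hf.mem (hs₁ x hx hxN)).2
  · intro x hx y hy e
    have hiff : x ∈ N ↔ y ∈ N := by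
      rw [← hsN x, ← hsN y]
      exact iff_of_eq (congrArg (· ∈ N) e)
    by_cases hxN : x ∈ N
    · have hyN := hiff.1 hxN
      change γ (s x) x = γ (s y) y at e
      rw [hs₂ x hx ⟨hx, hxN⟩, hs₂ y hy ⟨hy, hyN⟩] at e
      exact congrArg Subtype.val (hφ.injective (Subtype.ext e))
    · exact hf.inj (hs₁ x hx hxN) (hs₁ y hy (hiff.not.1 hxN)) e
  · intro y hy
    by_cases hyN : y ∈ N
    · obtain ⟨⟨x, hx⟩, e⟩ := hφ.surjective ⟨y, hy, hyN⟩
      refine ⟨x, hx.1, ?_⟩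
      change γ (s x) x = y
      rw [hs₂ x hx.1 hx, e]
    · obtain ⟨x, i, hxi, rfl⟩ : y ∈ matchedImage γ f := by
        by_contra h
        exact hyN (hZN (Or.inr ⟨hy, h⟩))
      have hxA := (hf.mem hxi).1
      have hxN : x ∉ N := fun h => hyN ((hNinv _ i.2 x).2 h)
      refine ⟨x, hxA, ?_⟩
      change γ (s x) x = γ i x
      rw [Option.some_injective _ ((hs₁ x hxA hxN).symm.trans hxi)]
  · have e : {x | x ∈ A ∧ s x = i} = ({x | f x = some i} \ N) ∪ {x | x ∈ A ∩ N ∧ s x = i} := by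
      ext x
      by_cases hxN : x ∈ N
      · simp [hxN]
      · simp only [mem_union, Set.mem_sdiff, mem_ofPred_eq, mem_inter_iff, hxN, and_false,
          false_and, or_false, not_false_eq_true, and_true]
        constructor
        · rintro ⟨hx, rfl⟩
          exact hs₁ x hx hxN
        · intro h
          have hxA := (hf.mem h).1
          exact ⟨hxA, Option.some_injective _ ((hs₁ x hxA hxN).symm.trans h)⟩
    rw [e]
    exact ((hf.measurable i).nullMeasurableSet.diff (NullMeasurableSet.of_null hN0)).union
      (NullMeasurableSet.of_null (measure_mono_null (fun x hx => hx.1.2) hN0))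

lemma IsCube.isCompact {n : ℕ} {C : Set (EucSp n)} (hC : IsCube n C) : IsCompact C := by
  obtain ⟨a, γ, -, rfl⟩ := hC
  refine IsCompact.image ?_ γ.continuous
  have e : {x : EucSp n | ∀ i, x i ∈ Icc 0 a}
      = EuclideanSpace.equiv (Fin n) ℝ ⁻¹' univ.pi fun _ => Icc 0 a := by
    ext x
    exact ⟨fun hx i _ => hx i, fun hx i => hx i (mem_univ i)⟩
  rw [e]
  exact (EuclideanSpace.equiv (Fin n) ℝ).toHomeomorph.isCompact_preimage.2
    (isCompact_univ_pi fun _ => isCompact_Icc)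

lemma IsCube.interior_nonempty {n : ℕ} {C : Set (EucSp n)} (hC : IsCube n C) :
    (interior C).Nonempty := by
  obtain ⟨a, γ, ha, rfl⟩ := hC
  have ho : IsOpen {x : EucSp n | ∀ i, x i ∈ Ioo 0 a} := by
    simp only [ofPred_forall]
    exact isOpen_iInter_of_finite fun i => isOpen_Ioo.preimage (by fun_prop)
  have hsub : {x : EucSp n | ∀ i, x i ∈ Ioo 0 a} ⊆ {x | ∀ i, x i ∈ Icc 0 a} :=
    fun x hx i => Ioo_subset_Icc_self (hx i)
  refine ⟨γ (WithLp.toLp 2 fun _ => a / 2), interior_maximal (image_mono hsub) (γ.toHomeomorph.isOpenMap _ ho) (mem_image_of_mem _ fun i => ?_)⟩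
  exact ⟨half_pos ha, half_lt_self ha⟩

/-- For every `n ≥ 3`, a closed ball in `ℝⁿ` and a cube in `ℝⁿ` of the same Lebesgue measure are
equidecomposable using Lebesgue measurable pieces (higher-dimensional measurable Tarski circle
squaring). -/
theorem ball_cube_measurable_equidecomposition (n : ℕ) (hn : 3 ≤ n)
    (c : EucSp n) (r : ℝ) (hr : 0 < r) (C : Set (EucSp n)) (hC : IsCube n C)
    (hvol : volume (Metric.closedBall c r) = volume C) :
    MeasurablyEquidecomposable n (Metric.closedBall c r) C :=
  measurablyEquidecomposable_of_volume_eq hn Metric.isBounded_closedBall hC.isCompact.isBounded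
    measurableSet_closedBall hC.isCompact.measurableSet
    ⟨c, Metric.ball_subset_interior_closedBall (Metric.mem_ball_self hr)⟩
    hC.interior_nonempty hvol
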